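/- Let R > 0 and let μ = e^{-U(x)} dx be a probability measure on ℝⁿ with U smooth and Hess U(x) ≥ R·Id for all x. Let Φ be the standard Gaussian cumulative distribution function and I(x) = Φ'(Φ⁻¹(x)) extended by I(0) = I(1) = 0. Then for every smooth function f : ℝⁿ → [0,1] with bounded derivatives, I(∫_{ℝⁿ} f dμ) ≤ ∫_{ℝⁿ} √( I(f)² + ‖∇f‖²/R ) dμ (Bobkov's inequality). -/

import Mathlib

open MeasureTheory Real

/-- The standard Gaussian density `Φ'(t) = (2π)^{-1/2} e^{-t²/2}`. -/
noncomputable def gaussPDF (t : ℝ) : ℝ := Real.exp (-t ^ 2 / 2) / Real.sqrt (2 * Real.pi)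

/-- The standard Gaussian cumulative distribution function `Φ`. -/
noncomputable def Phi (x : ℝ) : ℝ := ∫ s in Set.Iic x, gaussPDF s

/-- The inverse `Φ⁻¹` of the Gaussian cdf (on `(0,1)`). -/
noncomputable def PhiInv : ℝ → ℝ := Function.invFun Phi

/-- The Gaussian isoperimetric profile `I = Φ' ∘ Φ⁻¹`. -/
noncomputable def isoI (x : ℝ) : ℝ := gaussPDF (PhiInv x)

/-- The Gaussian isoperimetric profile extended by `I(0) = I(1) = 0`. -/
noncomputable def isoIbar (x : ℝ) : ℝ := if 0 < x ∧ x < 1 then isoI x else 0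

open Filter Topology Set
open scoped RealInnerProductSpace

section Profile

lemma gaussPDF_pos (t : ℝ) : 0 < gaussPDF t := by
  unfold gaussPDF; positivity

lemma gaussPDF_eq (t : ℝ) : gaussPDF t = ProbabilityTheory.gaussianPDFReal 0 1 t := by
  simp [gaussPDF, ProbabilityTheory.gaussianPDFReal, div_eq_inv_mul]

lemma gaussPDF_le_one (t : ℝ) : gaussPDF t ≤ 1 := by
  unfold gaussPDF
  rw [div_le_one (by positivity)]
  have h1 : Real.exp (-t ^ 2 / 2) ≤ 1 := Real.exp_le_one_iff.2 (by nlinarith [sq_nonneg t])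
  have h2 : (1 : ℝ) ≤ Real.sqrt (2 * Real.pi) :=
    Real.one_le_sqrt.2 (by nlinarith [Real.pi_gt_three])
  linarith

lemma continuous_gaussPDF : Continuous gaussPDF := by
  unfold gaussPDF; fun_prop

lemma hasDerivAt_gaussPDF (t : ℝ) : HasDerivAt gaussPDF (-t * gaussPDF t) t := by
  have h : HasDerivAt (fun t : ℝ => -t ^ 2 / 2) (-t) t := by
    have := ((hasDerivAt_pow 2 t).neg).div_const 2
    convert! this using 1
    norm_num; ring
  have := h.exp.div_const (Real.sqrt (2 * Real.pi))
  convert! this using 1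
  simp only [gaussPDF]; ring

lemma integrable_gaussPDF : Integrable gaussPDF := by
  have := ProbabilityTheory.integrable_gaussianPDFReal 0 1
  exact this.congr (ae_of_all _ fun t => (gaussPDF_eq t).symm)

lemma Phi_eq_cdf (x : ℝ) : Phi x = ProbabilityTheory.cdf (ProbabilityTheory.gaussianReal 0 1) x := by
  rw [ProbabilityTheory.cdf_eq_real, measureReal_def,
    ProbabilityTheory.gaussianReal_apply_eq_integral _ one_ne_zero, ENNReal.toReal_ofReal]
  · simp only [Phi, gaussPDF_eq]
  · exact integral_nonneg fun t => ProbabilityTheory.gaussianPDFReal_nonneg _ _ _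

lemma hasStrictDerivAt_Phi (x : ℝ) : HasStrictDerivAt Phi (gaussPDF x) x := by
  have h : Phi = fun x => (∫ s in Set.Iic (0 : ℝ), gaussPDF s) + ∫ s in (0 : ℝ)..x, gaussPDF s := by
    funext x
    rw [← intervalIntegral.integral_Iic_sub_Iic integrable_gaussPDF.integrableOn
      integrable_gaussPDF.integrableOn]
    simp [Phi]
  rw [h]
  apply HasStrictDerivAt.const_add
  exact intervalIntegral.integral_hasStrictDerivAt_right
    (continuous_gaussPDF.intervalIntegrable _ _)
    (continuous_gaussPDF.stronglyMeasurableAtFilter _ _) continuous_gaussPDF.continuousAt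

lemma Phi_strictMono : StrictMono Phi :=
  strictMono_of_deriv_pos fun x => by
    rw [(hasStrictDerivAt_Phi x).hasDerivAt.deriv]; exact gaussPDF_pos x

lemma Phi_pos (x : ℝ) : 0 < Phi x := by
  have h : 0 ≤ Phi (x - 1) := by
    rw [Phi_eq_cdf]; exact ProbabilityTheory.cdf_nonneg _ _
  exact h.trans_lt (Phi_strictMono (by linarith))

lemma Phi_lt_one (x : ℝ) : Phi x < 1 := by
  have h : Phi (x + 1) ≤ 1 := by
    rw [Phi_eq_cdf]; exact ProbabilityTheory.cdf_le_one _ _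
  exact (Phi_strictMono (by linarith)).trans_le h

lemma continuous_Phi : Continuous Phi :=
  continuous_iff_continuousAt.2 fun x => (hasStrictDerivAt_Phi x).hasDerivAt.continuousAt

lemma PhiInv_Phi (x : ℝ) : PhiInv (Phi x) = x :=
  Function.leftInverse_invFun Phi_strictMono.injective x

lemma exists_Phi_eq {y : ℝ} (h0 : 0 < y) (h1 : y < 1) : ∃ x, Phi x = y := by
  have hbot : Tendsto Phi atBot (𝓝 0) := by
    simp only [funext Phi_eq_cdf]; exact ProbabilityTheory.tendsto_cdf_atBot _
  have htop : Tendsto Phi atTop (𝓝 1) := by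
    simp only [funext Phi_eq_cdf]; exact ProbabilityTheory.tendsto_cdf_atTop _
  exact mem_range_of_exists_le_of_exists_ge continuous_Phi
    ((hbot.eventually (gt_mem_nhds h0)).exists.imp fun _ h => h.le)
    ((htop.eventually (lt_mem_nhds h1)).exists.imp fun _ h => h.le)

lemma isoI_pos (y : ℝ) : 0 < isoI y := gaussPDF_pos _

lemma hasDerivAt_PhiInv {y : ℝ} (h0 : 0 < y) (h1 : y < 1) :
    HasDerivAt PhiInv (isoI y)⁻¹ y := by
  obtain ⟨x, rfl⟩ := exists_Phi_eq h0 h1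
  have := (hasStrictDerivAt_Phi x).to_local_left_inverse (gaussPDF_pos x).ne'
    (Eventually.of_forall PhiInv_Phi)
  simpa [isoI, PhiInv_Phi] using this.hasDerivAt

lemma hasDerivAt_isoI {y : ℝ} (h0 : 0 < y) (h1 : y < 1) :
    HasDerivAt isoI (-PhiInv y) y := by
  have := (hasDerivAt_gaussPDF (PhiInv y)).comp y (hasDerivAt_PhiInv h0 h1)
  convert! this using 1
  have := (gaussPDF_pos (PhiInv y)).ne'
  simp only [isoI]; field_simp

lemma isoIbar_eq {y : ℝ} (h0 : 0 < y) (h1 : y < 1) : isoIbar y = isoI y := by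
  simp [isoIbar, h0, h1]

lemma isoIbar_nonneg (y : ℝ) : 0 ≤ isoIbar y := by
  unfold isoIbar; split_ifs
  · exact (isoI_pos y).le
  · exact le_rfl

lemma isoIbar_le_one (y : ℝ) : isoIbar y ≤ 1 := by
  unfold isoIbar; split_ifs
  · exact gaussPDF_le_one _
  · exact zero_le_one

lemma tendsto_gaussPDF_cocompact : Tendsto gaussPDF (cocompact ℝ) (𝓝 0) := by
  have h : Tendsto (fun t : ℝ => Real.exp (-t ^ 2 / 2)) (cocompact ℝ) (𝓝 0) := by
    have h2 : Tendsto (fun t : ℝ => t ^ 2 / 2) (cocompact ℝ) atTop := by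
      have := (tendsto_pow_atTop (α := ℝ) two_ne_zero).comp (tendsto_norm_cocompact_atTop (E := ℝ))
      have := this.atTop_div_const (two_pos : (0 : ℝ) < 2)
      simpa [Function.comp_def] using this
    refine (Real.tendsto_exp_neg_atTop_nhds_zero.comp h2).congr fun t => ?_
    simp [neg_div]
  have := h.div_const (Real.sqrt (2 * Real.pi))
  rwa [zero_div] at this

lemma exists_isoIbar_lt {δ : ℝ} (hδ : 0 < δ) :
    ∃ a b : ℝ, 0 < a ∧ b < 1 ∧ ∀ y, y < a ∨ b < y → isoIbar y < δ := by
  have h := tendsto_gaussPDF_cocompact.eventually (gt_mem_nhds hδ)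
  rw [cocompact_eq_atBot_atTop, eventually_sup] at h
  obtain ⟨A, hA⟩ := eventually_atBot.1 h.1
  obtain ⟨B, hB⟩ := eventually_atTop.1 h.2
  refine ⟨Phi A, Phi B, Phi_pos A, Phi_lt_one B, fun y hy => ?_⟩
  unfold isoIbar
  split_ifs with h01
  · obtain ⟨x, rfl⟩ := exists_Phi_eq h01.1 h01.2
    simp only [isoI, PhiInv_Phi, Phi_strictMono.lt_iff_lt] at hy ⊢
    rcases hy with hy | hy
    · exact hA x hy.le
    · exact hB x hy.le
  · exact hδ

lemma continuous_isoIbar : Continuous isoIbar := by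
  rw [continuous_iff_continuousAt]
  intro y
  by_cases h : 0 < y ∧ y < 1
  · have : isoIbar =ᶠ[𝓝 y] isoI := by
      filter_upwards [Ioo_mem_nhds h.1 h.2] with z hz using isoIbar_eq hz.1 hz.2
    exact (hasDerivAt_isoI h.1 h.2).continuousAt.congr this.symm
  · have hy : isoIbar y = 0 := by simp [isoIbar, h]
    rw [Metric.continuousAt_iff']
    intro δ hδ
    obtain ⟨a, b, ha, hb, hab⟩ := exists_isoIbar_lt hδ
    have hy' : y < a ∨ b < y := by
      by_cases h0 : 0 < y
      · exact Or.inr (hb.trans_le (not_lt.1 fun h1 => h ⟨h0, h1⟩))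
      · exact Or.inl ((not_lt.1 h0).trans_lt ha)
    have hev : ∀ᶠ z in 𝓝 y, z < a ∨ b < z := by
      rcases hy' with h1 | h1
      · exact (eventually_lt_nhds h1).mono fun _ => Or.inl
      · exact (eventually_gt_nhds h1).mono fun _ => Or.inr
    filter_upwards [hev] with z hz
    rw [hy, Real.dist_eq, sub_zero, abs_of_nonneg (isoIbar_nonneg z)]
    exact hab z hz

end Profile

section Laplace

variable {V : Type} [NormedAddCommGroup V] [InnerProductSpace ℝ V]
  [MeasurableSpace V] [BorelSpace V] [SecondCountableTopology V] {m : Measure V}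
  {F : Type} [NormedAddCommGroup F] [NormedSpace ℝ F]

omit [MeasurableSpace V] [BorelSpace V] [SecondCountableTopology V] in
lemma exp_inner_le (z w : V) : Real.exp ⟪z, w⟫ ≤ Real.exp (‖w‖ * ‖z‖) :=
  Real.exp_le_exp.2 ((real_inner_le_norm z w).trans_eq (mul_comm _ _))

lemma le_exp_self (t : ℝ) : t ≤ Real.exp t := by linarith [Real.add_one_le_exp t]

omit [InnerProductSpace ℝ V] [SecondCountableTopology V] [NormedSpace ℝ F] in
/-- Exponential moments of all orders are inherited by `z ↦ ‖z‖ * ψ z`. -/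
lemma integrable_exp_mul_norm_of_le {F' : Type} [NormedAddCommGroup F'] {ψ : V → F} {ψ' : V → F'}
    (hψ' : AEStronglyMeasurable ψ' m)
    (hint : ∀ a : ℝ, Integrable (fun z => Real.exp (a * ‖z‖) * ‖ψ z‖) m) {C : ℝ}
    (hle : ∀ z, ‖ψ' z‖ ≤ C * (‖z‖ * ‖ψ z‖)) (a : ℝ) :
    Integrable (fun z => Real.exp (a * ‖z‖) * ‖ψ' z‖) m := by
  refine ((hint (a + 1)).const_mul |C|).mono' ?_ (ae_of_all _ fun z => ?_)
  · exact (by fun_prop : Continuous fun z : V => Real.exp (a * ‖z‖)).aestronglyMeasurable.mul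
      hψ'.norm
  · rw [Real.norm_of_nonneg (by positivity), add_mul, one_mul, Real.exp_add]
    have h1 : ‖ψ' z‖ ≤ |C| * (Real.exp ‖z‖ * ‖ψ z‖) := by
      refine (hle z).trans (mul_le_mul (le_abs_self C) ?_ (by positivity) (abs_nonneg C))
      exact mul_le_mul_of_nonneg_right (le_exp_self _) (norm_nonneg _)
    calc Real.exp (a * ‖z‖) * ‖ψ' z‖
        ≤ Real.exp (a * ‖z‖) * (|C| * (Real.exp ‖z‖ * ‖ψ z‖)) :=
          mul_le_mul_of_nonneg_left h1 (Real.exp_pos _).le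
      _ = |C| * (Real.exp (a * ‖z‖) * Real.exp ‖z‖ * ‖ψ z‖) := by ring

omit [SecondCountableTopology V] in
lemma integrable_exp_inner_smul {ψ : V → F} (hψ : AEStronglyMeasurable ψ m)
    (hint : ∀ a : ℝ, Integrable (fun z => Real.exp (a * ‖z‖) * ‖ψ z‖) m) (w : V) :
    Integrable (fun z => Real.exp ⟪z, w⟫ • ψ z) m := by
  refine (hint ‖w‖).mono' ?_ (ae_of_all _ fun z => ?_)
  · exact (by fun_prop : Continuous fun z : V => Real.exp ⟪z, w⟫).aestronglyMeasurable.smul hψ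
  · rw [norm_smul, Real.norm_of_nonneg (Real.exp_pos _).le]
    exact mul_le_mul_of_nonneg_right (exp_inner_le z w) (norm_nonneg _)

lemma aestronglyMeasurable_innerSL_smulRight {ψ : V → F} (hψ : AEStronglyMeasurable ψ m) :
    AEStronglyMeasurable (fun z => (innerSL ℝ z).smulRight (ψ z)) m := by
  have h : Continuous fun p : V × F => (innerSL ℝ p.1).smulRight p.2 := by
    have : (fun p : V × F => (innerSL ℝ p.1).smulRight p.2)
        = fun p : V × F => ContinuousLinearMap.smulRightL ℝ V F (innerSL ℝ p.1) p.2 := rfl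
    rw [this]; fun_prop
  exact h.comp_aestronglyMeasurable
    ((continuous_id.aestronglyMeasurable (μ := m)).prodMk hψ)

omit [MeasurableSpace V] [BorelSpace V] [SecondCountableTopology V] in
lemma norm_innerSL_smulRight_le (ψ : V → F) (z : V) :
    ‖(innerSL ℝ z).smulRight (ψ z)‖ ≤ 1 * (‖z‖ * ‖ψ z‖) := by
  rw [ContinuousLinearMap.norm_smulRight_apply, innerSL_apply_norm, one_mul]

lemma hasFDerivAt_laplace {ψ : V → F} (hψ : AEStronglyMeasurable ψ m)
    (hint : ∀ a : ℝ, Integrable (fun z => Real.exp (a * ‖z‖) * ‖ψ z‖) m) (w : V) :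
    HasFDerivAt (fun w => ∫ z, Real.exp ⟪z, w⟫ • ψ z ∂m)
      (∫ z, Real.exp ⟪z, w⟫ • (innerSL ℝ z).smulRight (ψ z) ∂m) w := by
  have hexp (w : V) : AEStronglyMeasurable (fun z : V => Real.exp ⟪z, w⟫) m :=
    (by fun_prop : Continuous fun z : V => Real.exp ⟪z, w⟫).aestronglyMeasurable
  refine hasFDerivAt_integral_of_dominated_of_fderiv_le
    (s := Metric.ball w 1) (bound := fun z => Real.exp ((‖w‖ + 1) * ‖z‖) *
      ‖(innerSL ℝ z).smulRight (ψ z)‖)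
    (F' := fun w z => Real.exp ⟪z, w⟫ • (innerSL ℝ z).smulRight (ψ z))
    (Metric.ball_mem_nhds w one_pos) ?_ ?_ ?_ ?_ ?_ ?_
  · exact Eventually.of_forall fun w => (hexp w).smul hψ
  · exact integrable_exp_inner_smul hψ hint w
  · exact (hexp w).smul (aestronglyMeasurable_innerSL_smulRight hψ)
  · refine ae_of_all _ fun z x hx => ?_
    rw [norm_smul, Real.norm_of_nonneg (Real.exp_pos _).le]
    refine mul_le_mul_of_nonneg_right ((exp_inner_le z x).trans (Real.exp_le_exp.2 ?_))
      (norm_nonneg _)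
    refine mul_le_mul_of_nonneg_right ?_ (norm_nonneg _)
    have := norm_le_norm_add_norm_sub' x w
    rw [mem_ball_iff_norm] at hx
    linarith
  · exact integrable_exp_mul_norm_of_le (aestronglyMeasurable_innerSL_smulRight hψ) hint
      (norm_innerSL_smulRight_le ψ) _
  · refine ae_of_all _ fun z x _ => ?_
    have h1 : HasFDerivAt (fun w : V => Real.exp ⟪z, w⟫) (Real.exp ⟪z, x⟫ • innerSL ℝ z) x :=
      ((innerSL ℝ z).hasFDerivAt (x := x)).exp
    convert h1.smul_const (ψ z) using 1
    ext v
    simp [mul_smul]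

lemma contDiff_laplace (k : ℕ) : ∀ {F : Type} [NormedAddCommGroup F] [NormedSpace ℝ F]
    {ψ : V → F}, AEStronglyMeasurable ψ m →
    (∀ a : ℝ, Integrable (fun z => Real.exp (a * ‖z‖) * ‖ψ z‖) m) →
    ContDiff ℝ k (fun w => ∫ z, Real.exp ⟪z, w⟫ • ψ z ∂m) := by
  induction k with
  | zero =>
    intro F _ _ ψ hψ hint
    exact contDiff_zero.2 (continuous_iff_continuousAt.2 fun w =>
      (hasFDerivAt_laplace hψ hint w).continuousAt)
  | succ k ih =>
    intro F _ _ ψ hψ hint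
    push_cast
    rw [contDiff_succ_iff_hasFDerivAt]
    exact ⟨_, ih (aestronglyMeasurable_innerSL_smulRight hψ)
      (integrable_exp_mul_norm_of_le (aestronglyMeasurable_innerSL_smulRight hψ) hint
        (norm_innerSL_smulRight_le ψ)), hasFDerivAt_laplace hψ hint⟩

lemma hasDerivAt_laplace_line {ψ : V → ℝ} (hψ : AEStronglyMeasurable ψ m)
    (hint : ∀ a : ℝ, Integrable (fun z => Real.exp (a * ‖z‖) * ‖ψ z‖) m) (a : V) (r : ℝ) :
    HasDerivAt (fun r : ℝ => ∫ z, Real.exp ⟪z, r • a⟫ • ψ z ∂m)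
      (∫ z, Real.exp ⟪z, r • a⟫ • (⟪z, a⟫ * ψ z) ∂m) r := by
  have h1 : HasDerivAt (fun r : ℝ => r • a) a r := by
    simpa using (hasDerivAt_id r).smul_const a
  have h2 := (hasFDerivAt_laplace hψ hint (r • a)).comp_hasDerivAt r h1
  convert! h2 using 1
  have h3 : Integrable (fun z => Real.exp ⟪z, r • a⟫ • (innerSL ℝ z).smulRight (ψ z)) m :=
    integrable_exp_inner_smul (aestronglyMeasurable_innerSL_smulRight hψ)
      (integrable_exp_mul_norm_of_le (aestronglyMeasurable_innerSL_smulRight hψ) hint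
        (norm_innerSL_smulRight_le ψ)) _
  rw [ContinuousLinearMap.integral_apply h3]
  simp

end Laplace

section Heat

variable {V : Type} [NormedAddCommGroup V] [InnerProductSpace ℝ V] [FiniteDimensional ℝ V]
  [MeasurableSpace V] [BorelSpace V]

/-- The standard Gaussian density on a finite-dimensional Euclidean space. -/
noncomputable def gaussWeight (z : V) : ℝ :=
  Real.exp (-‖z‖ ^ 2 / 2) / ∫ y : V, Real.exp (-‖y‖ ^ 2 / 2)

/-- The heat semigroup `φ ↦ 𝔼[φ(x + √s Z)]` with `Z` a standard Gaussian vector. -/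
noncomputable def heat (s : ℝ) (φ : V → ℝ) (x : V) : ℝ :=
  ∫ z, gaussWeight z * φ (x + √s • z)

lemma integrable_exp_neg_mul_sq_norm {b : ℝ} (hb : 0 < b) :
    Integrable (fun z : V => Real.exp (-b * ‖z‖ ^ 2)) := by
  have h := (GaussianFourier.integrable_cexp_neg_mul_sq_norm_add (V := V) (b := (b : ℂ))
    (by simpa using hb) 0 0).norm
  refine h.congr (ae_of_all _ fun z => ?_)
  dsimp only
  rw [Complex.norm_exp]
  simp [← Complex.ofReal_pow, ← Complex.ofReal_mul, ← Complex.ofReal_neg]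

lemma integrable_exp_neg_sq_norm_div_two : Integrable (fun z : V => Real.exp (-‖z‖ ^ 2 / 2)) :=
  (integrable_exp_neg_mul_sq_norm (V := V) (b := 1 / 2) (by norm_num)).congr
    (ae_of_all _ fun z => by ring_nf)

lemma integral_exp_neg_sq_norm_div_two_pos : 0 < ∫ z : V, Real.exp (-‖z‖ ^ 2 / 2) :=
  integral_exp_pos integrable_exp_neg_sq_norm_div_two

lemma gaussWeight_pos (z : V) : 0 < gaussWeight z :=
  div_pos (Real.exp_pos _) integral_exp_neg_sq_norm_div_two_pos

lemma continuous_gaussWeight : Continuous (gaussWeight : V → ℝ) := by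
  unfold gaussWeight; fun_prop

lemma integral_gaussWeight : ∫ z : V, gaussWeight z = 1 := by
  unfold gaussWeight
  rw [integral_div, div_self integral_exp_neg_sq_norm_div_two_pos.ne']

lemma integrable_exp_mul_gaussWeight (a : ℝ) :
    Integrable (fun z : V => Real.exp (a * ‖z‖) * gaussWeight z) := by
  have h := ((integrable_exp_neg_mul_sq_norm (V := V) (b := 1 / 4) (by norm_num)).const_mul
    (Real.exp (a ^ 2))).div_const (∫ y : V, Real.exp (-‖y‖ ^ 2 / 2))
  refine h.mono' ?_ (ae_of_all _ fun z => ?_)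
  · exact ((by fun_prop : Continuous fun z : V => Real.exp (a * ‖z‖)).mul
      continuous_gaussWeight).aestronglyMeasurable
  · have := gaussWeight_pos z
    rw [Real.norm_of_nonneg (by positivity)]
    unfold gaussWeight
    rw [← mul_div_assoc]
    refine div_le_div_of_nonneg_right ?_ integral_exp_neg_sq_norm_div_two_pos.le
    rw [← Real.exp_add, ← Real.exp_add, Real.exp_le_exp]
    nlinarith [sq_nonneg (a - ‖z‖ / 2)]

lemma integrable_gaussWeight : Integrable (gaussWeight : V → ℝ) := by
  simpa using integrable_exp_mul_gaussWeight (V := V) 0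

lemma integrable_norm_mul_gaussWeight : Integrable (fun z : V => ‖z‖ * gaussWeight z) := by
  refine (integrable_exp_mul_gaussWeight (V := V) 1).mono'
    (continuous_norm.mul continuous_gaussWeight).aestronglyMeasurable (ae_of_all _ fun z => ?_)
  rw [Real.norm_of_nonneg (mul_nonneg (norm_nonneg _) (gaussWeight_pos z).le), one_mul]
  exact mul_le_mul_of_nonneg_right (le_exp_self _) (gaussWeight_pos z).le

lemma gaussWeight_sub (z w : V) :
    gaussWeight (z - w) = Real.exp (-‖w‖ ^ 2 / 2) * (Real.exp ⟪z, w⟫ * gaussWeight z) := by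
  unfold gaussWeight
  rw [← mul_div_assoc, ← mul_div_assoc, ← Real.exp_add, ← Real.exp_add, norm_sub_sq_real]
  congr 2; ring

variable {φ : V → ℝ} {C : ℝ}

lemma heat_add_sqrt_smul (s : ℝ) (x w : V) :
    heat s φ (x + √s • w) = Real.exp (-‖w‖ ^ 2 / 2) *
      ∫ z, Real.exp ⟪z, w⟫ • (gaussWeight z * φ (x + √s • z)) := by
  unfold heat
  rw [← integral_sub_right_eq_self _ w, ← integral_const_mul]
  refine integral_congr_ae (ae_of_all _ fun z => ?_)
  simp only [gaussWeight_sub, smul_eq_mul]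
  rw [show x + √s • w + √s • (z - w) = x + √s • z by rw [smul_sub]; abel]
  ring

lemma abs_heat_le (hC : ∀ x, |φ x| ≤ C) (s : ℝ) (x : V) : |heat s φ x| ≤ C := by
  have h := norm_integral_le_of_norm_le (integrable_gaussWeight.mul_const C)
    (f := fun z : V => gaussWeight z * φ (x + √s • z)) (ae_of_all _ fun z => by
      rw [norm_mul, Real.norm_of_nonneg (gaussWeight_pos z).le]
      exact mul_le_mul_of_nonneg_left (hC _) (gaussWeight_pos z).le)
  rwa [integral_mul_const, integral_gaussWeight, one_mul] at h

lemma aestronglyMeasurable_inner_mul_heat (hφ : Continuous φ) (s : ℝ) (x a : V) :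
    AEStronglyMeasurable (fun z => ⟪z, a⟫ * (gaussWeight z * φ (x + √s • z))) volume :=
  ((by fun_prop : Continuous fun z : V => ⟪z, a⟫).mul
    (continuous_gaussWeight.mul (hφ.comp (by fun_prop)))).aestronglyMeasurable

section Bounded

variable (hφ : Continuous φ) (hC : ∀ x, |φ x| ≤ C)
include hφ hC

lemma integrable_heat (s : ℝ) (x : V) :
    Integrable (fun z => gaussWeight z * φ (x + √s • z)) := by
  refine (integrable_gaussWeight.mul_const C).mono' ?_ (ae_of_all _ fun z => ?_)
  · exact (continuous_gaussWeight.mul (hφ.comp (by fun_prop))).aestronglyMeasurable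
  · rw [norm_mul, Real.norm_of_nonneg (gaussWeight_pos z).le]
    exact mul_le_mul_of_nonneg_left (hC _) (gaussWeight_pos z).le

lemma continuous_heat : Continuous (fun p : ℝ × V => heat p.1 φ p.2) := by
  refine continuous_of_dominated (bound := fun z => gaussWeight z * C)
    (fun p => (integrable_heat hφ hC p.1 p.2).aestronglyMeasurable)
    (fun p => ae_of_all _ fun z => ?_) (integrable_gaussWeight.mul_const C)
    (ae_of_all _ fun z => ?_)
  · rw [norm_mul, Real.norm_of_nonneg (gaussWeight_pos z).le]
    exact mul_le_mul_of_nonneg_left (hC _) (gaussWeight_pos z).le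
  · exact continuous_const.mul (hφ.comp (by fun_prop))

lemma integrable_exp_mul_heat (s : ℝ) (x : V) (a : ℝ) :
    Integrable (fun z => Real.exp (a * ‖z‖) * ‖gaussWeight z * φ (x + √s • z)‖) := by
  refine ((integrable_exp_mul_gaussWeight a).mul_const C).mono' ?_ (ae_of_all _ fun z => ?_)
  · exact (((by fun_prop : Continuous fun z : V => Real.exp (a * ‖z‖))).mul
      (continuous_gaussWeight.mul (hφ.comp (by fun_prop))).norm).aestronglyMeasurable
  · have := gaussWeight_pos z
    rw [norm_mul, norm_norm, norm_mul, Real.norm_of_nonneg this.le,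
      Real.norm_of_nonneg (Real.exp_pos _).le, ← mul_assoc]
    exact mul_le_mul_of_nonneg_left (hC _) (by positivity)

lemma contDiff_heat {s : ℝ} (hs : 0 < s) : ContDiff ℝ 2 (heat s φ) := by
  have h1 : heat s φ = fun y => Real.exp (-‖(√s)⁻¹ • y‖ ^ 2 / 2) *
      ∫ z, Real.exp ⟪z, (√s)⁻¹ • y⟫ • (gaussWeight z * φ (0 + √s • z)) := by
    funext y
    rw [← heat_add_sqrt_smul, smul_inv_smul₀ (Real.sqrt_pos.2 hs).ne', zero_add]
  have h2 := contDiff_laplace (m := volume) 2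
    (integrable_heat hφ hC s 0).aestronglyMeasurable (integrable_exp_mul_heat hφ hC s 0)
  have h3 : ContDiff ℝ 2 (fun y : V => (√s)⁻¹ • y) := contDiff_const_smul _
  rw [h1]
  exact ((h3.norm_sq ℝ).neg.div_const 2).exp.mul (h2.comp h3)

lemma hasDerivAt_heat_line {s : ℝ} (hs : 0 < s) (x v : V) (r : ℝ) :
    HasDerivAt (fun r : ℝ => heat s φ (x + r • v)) (fderiv ℝ (heat s φ) (x + r • v) v) r := by
  have h1 : HasDerivAt (fun r : ℝ => x + r • v) v r := by
    simpa using ((hasDerivAt_id r).smul_const v).const_add x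
  exact (((contDiff_heat hφ hC hs).differentiable (by norm_num)) _).hasFDerivAt.comp_hasDerivAt r h1

lemma hasDerivAt_fderiv_heat_line {s : ℝ} (hs : 0 < s) (x v w : V) (r : ℝ) :
    HasDerivAt (fun r : ℝ => fderiv ℝ (heat s φ) (x + r • v) w)
      (fderiv ℝ (fun y => fderiv ℝ (heat s φ) y w) (x + r • v) v) r := by
  have h1 : HasDerivAt (fun r : ℝ => x + r • v) v r := by
    simpa using ((hasDerivAt_id r).smul_const v).const_add x
  have h2 : ContDiff ℝ 1 (fun y => fderiv ℝ (heat s φ) y w) :=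
    ((contDiff_heat hφ hC hs).fderiv_right (m := 1) (by norm_num)).clm_apply contDiff_const
  exact ((h2.differentiable (by norm_num)) _).hasFDerivAt.comp_hasDerivAt r h1

/-- The explicit first derivative along a line, obtained by differentiating the Gaussian kernel. -/
lemma fderiv_heat_line {s : ℝ} (hs : 0 < s) (x v : V) (r : ℝ) :
    fderiv ℝ (heat s φ) (x + r • v) v =
      Real.exp (-(r ^ 2 * ‖(√s)⁻¹ • v‖ ^ 2) / 2) *
        ((∫ z, Real.exp ⟪z, r • (√s)⁻¹ • v⟫ • (⟪z, (√s)⁻¹ • v⟫ * (gaussWeight z * φ (x + √s • z))))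
        - r * ‖(√s)⁻¹ • v‖ ^ 2 *
          ∫ z, Real.exp ⟪z, r • (√s)⁻¹ • v⟫ • (gaussWeight z * φ (x + √s • z))) := by
  have h0 := (Real.sqrt_pos.2 hs).ne'
  set a := (√s)⁻¹ • v with ha
  have h1 : (fun r : ℝ => heat s φ (x + r • v)) = fun r : ℝ =>
      Real.exp (-(r ^ 2 * ‖a‖ ^ 2) / 2) *
        ∫ z, Real.exp ⟪z, r • a⟫ • (gaussWeight z * φ (x + √s • z)) := by
    funext r
    have : r • v = √s • r • a := by rw [ha, smul_comm r, smul_inv_smul₀ h0]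
    rw [this, heat_add_sqrt_smul, norm_smul, mul_pow, Real.norm_eq_abs, sq_abs]
  have h2 := hasDerivAt_laplace_line (m := volume)
    (integrable_heat hφ hC s x).aestronglyMeasurable (integrable_exp_mul_heat hφ hC s x) a r
  have h3 : HasDerivAt (fun r : ℝ => Real.exp (-(r ^ 2 * ‖a‖ ^ 2) / 2))
      (Real.exp (-(r ^ 2 * ‖a‖ ^ 2) / 2) * (-r * ‖a‖ ^ 2)) r := by
    have := ((((hasDerivAt_pow 2 r).mul_const (‖a‖ ^ 2)).fun_neg).div_const 2).exp
    convert! this using 1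
    push_cast; ring
  have h4 := hasDerivAt_heat_line hφ hC hs x v r
  rw [h1] at h4
  rw [h4.unique (h3.mul h2)]
  ring

lemma fderiv_heat_apply {s : ℝ} (hs : 0 < s) (x v : V) :
    fderiv ℝ (heat s φ) x v =
      ∫ z, ⟪z, (√s)⁻¹ • v⟫ * (gaussWeight z * φ (x + √s • z)) := by
  have := fderiv_heat_line hφ hC hs x v 0
  simpa using this

lemma integrable_exp_mul_inner_mul_heat (s : ℝ) (x a : V) (c : ℝ) :
    Integrable (fun z => Real.exp (c * ‖z‖) * ‖⟪z, a⟫ * (gaussWeight z * φ (x + √s • z))‖) := by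
  refine integrable_exp_mul_norm_of_le (aestronglyMeasurable_inner_mul_heat hφ s x a)
    (integrable_exp_mul_heat hφ hC s x) (C := ‖a‖) (fun z => ?_) c
  rw [norm_mul, ← mul_assoc ‖a‖, mul_comm ‖a‖]
  exact mul_le_mul_of_nonneg_right (norm_inner_le_norm z a) (norm_nonneg _)

lemma integrable_inner_sq_mul_heat (s : ℝ) (x a : V) :
    Integrable (fun z => ⟪z, a⟫ * (⟪z, a⟫ * (gaussWeight z * φ (x + √s • z)))) := by
  have h1 : AEStronglyMeasurable
      (fun z => ⟪z, a⟫ * (⟪z, a⟫ * (gaussWeight z * φ (x + √s • z)))) volume :=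
    (by fun_prop : Continuous fun z : V => ⟪z, a⟫).aestronglyMeasurable.mul
      (aestronglyMeasurable_inner_mul_heat hφ s x a)
  have h2 (z : V) : ‖⟪z, a⟫ * (⟪z, a⟫ * (gaussWeight z * φ (x + √s • z)))‖ ≤
      ‖a‖ * (‖z‖ * ‖⟪z, a⟫ * (gaussWeight z * φ (x + √s • z))‖) := by
    rw [norm_mul, ← mul_assoc ‖a‖, mul_comm ‖a‖]
    exact mul_le_mul_of_nonneg_right (norm_inner_le_norm z a) (norm_nonneg _)
  have h := integrable_exp_mul_norm_of_le h1
    (integrable_exp_mul_inner_mul_heat hφ hC s x a) h2 0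
  simp only [zero_mul, Real.exp_zero, one_mul] at h
  exact (integrable_norm_iff h1).1 h

lemma fderiv_fderiv_heat_apply {s : ℝ} (hs : 0 < s) (x v : V) :
    fderiv ℝ (fun y => fderiv ℝ (heat s φ) y v) x v =
      ∫ z : V, (⟪z, v⟫ ^ 2 - ‖v‖ ^ 2) / s * (gaussWeight z * φ (x + √s • z)) := by
  have h0 := (Real.sqrt_pos.2 hs).ne'
  have h1 := hasDerivAt_fderiv_heat_line hφ hC hs x v v 0
  have h2 : (fun r : ℝ => fderiv ℝ (heat s φ) (x + r • v) v) = _ :=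
    funext fun r => fderiv_heat_line hφ hC hs x v r
  rw [h2] at h1
  set a := (√s)⁻¹ • v with ha
  have h3 := hasDerivAt_laplace_line (m := volume)
    (aestronglyMeasurable_inner_mul_heat hφ s x a)
    (integrable_exp_mul_inner_mul_heat hφ hC s x a) a 0
  have h4 := hasDerivAt_laplace_line (m := volume)
    (integrable_heat hφ hC s x).aestronglyMeasurable (integrable_exp_mul_heat hφ hC s x) a 0
  have h5 : HasDerivAt (fun r : ℝ => Real.exp (-(r ^ 2 * ‖a‖ ^ 2) / 2)) 0 0 := by
    have := ((((hasDerivAt_pow 2 (0 : ℝ)).mul_const (‖a‖ ^ 2)).fun_neg).div_const 2).exp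
    convert! this using 1
    push_cast; ring
  have h6 := h5.mul (h3.sub (((hasDerivAt_id (0 : ℝ)).mul_const (‖a‖ ^ 2)).mul h4))
  have h7 := h1.unique h6
  simp only [zero_smul, add_zero] at h7
  rw [h7]
  simp only [inner_zero_right, Real.exp_zero, one_smul, zero_mul, id, one_mul, add_zero,
    zero_add, ne_eq, OfNat.ofNat_ne_zero, not_false_eq_true, zero_pow, neg_zero, zero_div]
  rw [← integral_const_mul, ← integral_sub (integrable_inner_sq_mul_heat hφ hC s x a)
    ((integrable_heat hφ hC s x).const_mul _)]
  refine integral_congr_ae (ae_of_all _ fun z => ?_)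
  simp only [ha, inner_smul_right, norm_smul, norm_inv, Real.norm_eq_abs, mul_pow, inv_pow,
    sq_abs, Real.sq_sqrt hs.le]
  have h8 : (√s)⁻¹ * (√s)⁻¹ = s⁻¹ := by rw [← mul_inv, Real.mul_self_sqrt hs.le]
  linear_combination (⟪z, v⟫ ^ 2 * gaussWeight z * φ (x + √s • z)) * h8

end Bounded

end Heat

section HeatEquation

variable {V : Type} [NormedAddCommGroup V] [InnerProductSpace ℝ V] [FiniteDimensional ℝ V]
  [MeasurableSpace V] [BorelSpace V] {φ : V → ℝ} {C : ℝ}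

lemma integral_comp_sqrt_smul {s : ℝ} (hs : 0 < s) (F : V → ℝ) :
    ∫ z, F (√s • z) = Real.exp (-(Module.finrank ℝ V / 2) * Real.log s) * ∫ y, F y := by
  have h : (√s ^ Module.finrank ℝ V)⁻¹ =
      Real.exp (-(Module.finrank ℝ V / 2) * Real.log s) := by
    rw [show √s = Real.exp (Real.log s / 2) by
      rw [← Real.log_sqrt hs.le, Real.exp_log (Real.sqrt_pos.2 hs)],
      ← Real.exp_nat_mul, ← Real.exp_neg]
    congr 1; ring
  rw [Measure.integral_comp_smul, smul_eq_mul, abs_of_nonneg (by positivity), h]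

lemma integrable_sq_norm_mul_exp_neg {b : ℝ} (hb : 0 < b) :
    Integrable (fun z : V => ‖z‖ ^ 2 * Real.exp (-b * ‖z‖ ^ 2)) := by
  refine ((integrable_exp_neg_mul_sq_norm (V := V) (half_pos hb)).const_mul (2 / b)).mono'
    (by fun_prop : Continuous fun z : V => ‖z‖ ^ 2 * Real.exp (-b * ‖z‖ ^ 2)).aestronglyMeasurable
    (ae_of_all _ fun z => ?_)
  rw [Real.norm_of_nonneg (by positivity)]
  have h1 := le_exp_self (b / 2 * ‖z‖ ^ 2)
  have h2 : ‖z‖ ^ 2 ≤ 2 / b * Real.exp (b / 2 * ‖z‖ ^ 2) := by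
    rw [div_mul_eq_mul_div, le_div_iff₀ hb]; linarith
  calc ‖z‖ ^ 2 * Real.exp (-b * ‖z‖ ^ 2)
      ≤ 2 / b * Real.exp (b / 2 * ‖z‖ ^ 2) * Real.exp (-b * ‖z‖ ^ 2) := by gcongr
    _ = 2 / b * Real.exp (-(b / 2) * ‖z‖ ^ 2) := by
      rw [mul_assoc, ← Real.exp_add]; congr 2; ring

omit [InnerProductSpace ℝ V] [FiniteDimensional ℝ V] [MeasurableSpace V] [BorelSpace V] in
lemma exp_neg_sq_norm_div_le {s s₀ : ℝ} (h0 : 0 < s) (h2 : s < 2 * s₀) (y : V) :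
    Real.exp (-‖y‖ ^ 2 / (2 * s)) ≤ Real.exp (-(1 / (4 * s₀)) * ‖y‖ ^ 2) := by
  rw [Real.exp_le_exp]
  have h3 : 1 / (4 * s₀) ≤ 1 / (2 * s) := one_div_le_one_div_of_le (by positivity) (by linarith)
  calc -‖y‖ ^ 2 / (2 * s) = -(1 / (2 * s) * ‖y‖ ^ 2) := by ring
    _ ≤ -(1 / (4 * s₀) * ‖y‖ ^ 2) := neg_le_neg (by gcongr)
    _ = _ := by ring

lemma hasDerivAt_integral_exp_neg_sq_norm_div (hφ : Continuous φ) (hC : ∀ x, |φ x| ≤ C)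
    {s : ℝ} (hs : 0 < s) (x : V) :
    Integrable (fun y => ‖y‖ ^ 2 / (2 * s ^ 2) * (Real.exp (-‖y‖ ^ 2 / (2 * s)) * φ (x + y))) ∧
    HasDerivAt (fun s : ℝ => ∫ y, Real.exp (-‖y‖ ^ 2 / (2 * s)) * φ (x + y))
      (∫ y, ‖y‖ ^ 2 / (2 * s ^ 2) * (Real.exp (-‖y‖ ^ 2 / (2 * s)) * φ (x + y))) s := by
  have hb : 0 < 1 / (4 * s) := by positivity
  have hφx : Continuous fun y => φ (x + y) := by fun_prop
  have hcont (s : ℝ) : Continuous fun y => Real.exp (-‖y‖ ^ 2 / (2 * s)) * φ (x + y) := by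
    fun_prop
  refine hasDerivAt_integral_of_dominated_loc_of_deriv_le (s := Ioo (s / 2) (2 * s))
    (F' := fun s y => ‖y‖ ^ 2 / (2 * s ^ 2) * (Real.exp (-‖y‖ ^ 2 / (2 * s)) * φ (x + y)))
    (bound := fun y => 2 / s ^ 2 * C * (‖y‖ ^ 2 * Real.exp (-(1 / (4 * s)) * ‖y‖ ^ 2)))
    (Ioo_mem_nhds (by linarith) (by linarith))
    (Eventually.of_forall fun s => (hcont s).aestronglyMeasurable) ?_ ?_ ?_ ?_ ?_
  · refine ((integrable_exp_neg_mul_sq_norm (V := V) hb).mul_const C).mono'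
      (hcont s).aestronglyMeasurable (ae_of_all _ fun y => ?_)
    rw [norm_mul, Real.norm_of_nonneg (Real.exp_pos _).le]
    exact mul_le_mul (exp_neg_sq_norm_div_le hs (by linarith) y) (hC _) (norm_nonneg _)
      (Real.exp_pos _).le
  · have := hcont s
    exact (by fun_prop : Continuous fun y => ‖y‖ ^ 2 / (2 * s ^ 2) *
      (Real.exp (-‖y‖ ^ 2 / (2 * s)) * φ (x + y))).aestronglyMeasurable
  · refine ae_of_all _ fun y t ht => ?_
    have ht0 : 0 < t := by linarith [ht.1]
    have h1 : 1 / (2 * t ^ 2) ≤ 2 / s ^ 2 := by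
      rw [div_le_div_iff₀ (by positivity) (by positivity)]
      nlinarith [ht.1]
    rw [norm_mul, norm_mul, Real.norm_of_nonneg (by positivity : 0 ≤ ‖y‖ ^ 2 / (2 * t ^ 2)),
      Real.norm_of_nonneg (Real.exp_pos _).le]
    calc ‖y‖ ^ 2 / (2 * t ^ 2) * (Real.exp (-‖y‖ ^ 2 / (2 * t)) * ‖φ (x + y)‖)
        = 1 / (2 * t ^ 2) * ‖y‖ ^ 2 * (Real.exp (-‖y‖ ^ 2 / (2 * t)) * ‖φ (x + y)‖) := by ring
      _ ≤ 2 / s ^ 2 * ‖y‖ ^ 2 * (Real.exp (-(1 / (4 * s)) * ‖y‖ ^ 2) * C) := by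
        exact mul_le_mul (by gcongr) (mul_le_mul (exp_neg_sq_norm_div_le ht0 ht.2 y) (hC _)
          (norm_nonneg _) (Real.exp_pos _).le) (by positivity) (by positivity)
      _ = _ := by ring
  · exact (integrable_sq_norm_mul_exp_neg hb).const_mul _
  · refine ae_of_all _ fun y t ht => ?_
    have ht0 : t ≠ 0 := by have := ht.1; linarith
    have h1 : HasDerivAt (fun t : ℝ => -‖y‖ ^ 2 / (2 * t)) (‖y‖ ^ 2 / (2 * t ^ 2)) t := by
      have := (((hasDerivAt_id t).const_mul 2).inv (mul_ne_zero two_ne_zero ht0)).const_mul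
        (-‖y‖ ^ 2)
      convert! this using 1
      simp only [id]; field_simp
    have h2 := h1.exp.mul_const (φ (x + y))
    convert! h2 using 1
    ring

lemma hasDerivAt_heat_time (hφ : Continuous φ) (hC : ∀ x, |φ x| ≤ C) {s : ℝ} (hs : 0 < s)
    (x : V) :
    HasDerivAt (fun s => heat s φ x) (∫ z, (‖z‖ ^ 2 - Module.finrank ℝ V) / (2 * s) *
      (gaussWeight z * φ (x + √s • z))) s := by
  set d : ℝ := ((Module.finrank ℝ V : ℕ) : ℝ) with hd
  set Z : ℝ := ∫ y : V, Real.exp (-‖y‖ ^ 2 / 2) with hZ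
  have hnorm {s : ℝ} (hs : 0 < s) (z : V) : ‖√s • z‖ ^ 2 = s * ‖z‖ ^ 2 := by
    rw [norm_smul, mul_pow, Real.norm_eq_abs, sq_abs, Real.sq_sqrt hs.le]
  have h1 : (fun s => heat s φ x) =ᶠ[𝓝 s] fun s => Real.exp (-(d / 2) * Real.log s) *
      (∫ y, Real.exp (-‖y‖ ^ 2 / (2 * s)) * φ (x + y)) / Z := by
    filter_upwards [lt_mem_nhds hs] with s hs
    rw [← integral_comp_sqrt_smul hs fun y => Real.exp (-‖y‖ ^ 2 / (2 * s)) * φ (x + y),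
      ← integral_div]
    refine integral_congr_ae (ae_of_all _ fun z => ?_)
    simp only [gaussWeight, hnorm hs]
    rw [show -(s * ‖z‖ ^ 2) / (2 * s) = -‖z‖ ^ 2 / 2 by field_simp]
    ring
  have h2 : HasDerivAt (fun s : ℝ => Real.exp (-(d / 2) * Real.log s))
      (Real.exp (-(d / 2) * Real.log s) * (-(d / 2) * s⁻¹)) s :=
    ((Real.hasDerivAt_log hs.ne').const_mul _).exp
  obtain ⟨hint, h3⟩ := hasDerivAt_integral_exp_neg_sq_norm_div hφ hC hs x
  refine (((h2.mul h3).div_const Z).congr_of_eventuallyEq h1).congr_deriv ?_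
  have h4 := integral_comp_sqrt_smul hs fun y => Real.exp (-‖y‖ ^ 2 / (2 * s)) * φ (x + y)
  have h5 := integral_comp_sqrt_smul hs fun y =>
    ‖y‖ ^ 2 / (2 * s ^ 2) * (Real.exp (-‖y‖ ^ 2 / (2 * s)) * φ (x + y))
  have hi : Integrable (fun z => ‖√s • z‖ ^ 2 / (2 * s ^ 2) *
      (Real.exp (-‖√s • z‖ ^ 2 / (2 * s)) * φ (x + √s • z))) :=
    hint.comp_smul (Real.sqrt_pos.2 hs).ne'
  have hw (z : V) : Real.exp (-(s * ‖z‖ ^ 2) / (2 * s)) = Z * gaussWeight z := by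
    rw [show -(s * ‖z‖ ^ 2) / (2 * s) = -‖z‖ ^ 2 / 2 by field_simp, gaussWeight,
      mul_div_cancel₀ _ integral_exp_neg_sq_norm_div_two_pos.ne']
  have hZ0 : Z ≠ 0 := integral_exp_neg_sq_norm_div_two_pos.ne'
  rw [← h5, mul_right_comm, ← h4]
  simp only [hnorm hs, hw, mul_assoc Z] at hi ⊢
  have hi2 : Integrable (fun z => s * ‖z‖ ^ 2 / (2 * s ^ 2) *
      (gaussWeight z * φ (x + √s • z))) := by
    refine (hi.const_mul Z⁻¹).congr (ae_of_all _ fun z => ?_)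
    field_simp
  have e1 : ∫ z, s * ‖z‖ ^ 2 / (2 * s ^ 2) * (Z * (gaussWeight z * φ (x + √s • z))) =
      Z * ∫ z, s * ‖z‖ ^ 2 / (2 * s ^ 2) * (gaussWeight z * φ (x + √s • z)) := by
    rw [← integral_const_mul]; congr 1; funext z; ring
  have e2 : ∫ z, (‖z‖ ^ 2 - d) / (2 * s) * (gaussWeight z * φ (x + √s • z)) =
      (∫ z, s * ‖z‖ ^ 2 / (2 * s ^ 2) * (gaussWeight z * φ (x + √s • z))) -
      d / (2 * s) * ∫ z, gaussWeight z * φ (x + √s • z) := by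
    rw [← integral_const_mul, ← integral_sub hi2 ((integrable_heat hφ hC s x).const_mul _)]
    congr 1; funext z; field_simp
  rw [e1, e2, integral_const_mul]
  field_simp
  ring

/-- `heat s φ` solves the heat equation `∂ₛ u = ½ Δ u`. -/
lemma hasDerivAt_heat {ι : Type*} [Fintype ι] (b : OrthonormalBasis ι ℝ V)
    (hφ : Continuous φ) (hC : ∀ x, |φ x| ≤ C) {s : ℝ} (hs : 0 < s) (x : V) :
    HasDerivAt (fun s => heat s φ x)
      (1 / 2 * ∑ i, fderiv ℝ (fun y => fderiv ℝ (heat s φ) y (b i)) x (b i)) s := by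
  refine (hasDerivAt_heat_time hφ hC hs x).congr_deriv ?_
  simp only [fderiv_fderiv_heat_apply hφ hC hs]
  have hint (i : ι) : Integrable (fun z => (⟪z, b i⟫ ^ 2 - ‖b i‖ ^ 2) / s *
      (gaussWeight z * φ (x + √s • z))) := by
    refine (((integrable_inner_sq_mul_heat hφ hC s x (b i)).sub
      ((integrable_heat hφ hC s x).const_mul (‖b i‖ ^ 2))).const_mul s⁻¹).congr
      (ae_of_all _ fun z => ?_)
    simp only [Pi.sub_apply]; ring
  rw [← integral_finsetSum _ fun i _ => hint i, ← integral_const_mul]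
  refine integral_congr_ae (ae_of_all _ fun z => ?_)
  have h1 : ∑ i, ⟪z, b i⟫ ^ 2 = ‖z‖ ^ 2 := b.sum_sq_inner_left z
  have h2 : (Module.finrank ℝ V : ℝ) = ∑ i, ‖b i‖ ^ 2 := by
    simp [Module.finrank_eq_card_basis b.toBasis]
  simp only
  rw [← Finset.sum_mul, ← Finset.sum_div, Finset.sum_sub_distrib, h1, h2]
  field_simp

/-- The heat semigroup commutes with derivatives of `C¹` data. -/
lemma fderiv_heat_of_contDiff (hφ : ContDiff ℝ 1 φ) (hC : ∀ x, |φ x| ≤ C) {C' : ℝ}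
    (hC' : ∀ x, ‖fderiv ℝ φ x‖ ≤ C') (s : ℝ) (x v : V) :
    fderiv ℝ (heat s φ) x v = heat s (fun y => fderiv ℝ φ y v) x := by
  have hc : Continuous (fderiv ℝ φ) := hφ.continuous_fderiv one_ne_zero
  have hcont : Continuous fun z => gaussWeight z • fderiv ℝ φ (x + √s • z) :=
    continuous_gaussWeight.smul (hc.comp (by fun_prop))
  have hb (z y : V) : ‖gaussWeight z • fderiv ℝ φ y‖ ≤ gaussWeight z * C' := by
    rw [norm_smul, Real.norm_of_nonneg (gaussWeight_pos z).le]
    exact mul_le_mul_of_nonneg_left (hC' _) (gaussWeight_pos z).le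
  have h : HasFDerivAt (heat s φ) (∫ z, gaussWeight z • fderiv ℝ φ (x + √s • z)) x := by
    refine hasFDerivAt_integral_of_dominated_of_fderiv_le (s := univ)
      (F' := fun x z => gaussWeight z • fderiv ℝ φ (x + √s • z))
      (bound := fun z => gaussWeight z * C') univ_mem ?_ ?_ ?_ ?_ ?_ ?_
    · exact Eventually.of_forall fun x =>
        (integrable_heat hφ.continuous hC s x).aestronglyMeasurable
    · exact integrable_heat hφ.continuous hC s x
    · exact hcont.aestronglyMeasurable
    · exact ae_of_all _ fun z x _ => hb z _
    · exact integrable_gaussWeight.mul_const C'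
    · refine ae_of_all _ fun z x _ => ?_
      have h1 := ((hφ.differentiable one_ne_zero) (x + √s • z)).hasFDerivAt
      exact ((h1.comp x ((hasFDerivAt_id x).add_const (√s • z)))).const_mul (gaussWeight z)
  rw [h.fderiv, ContinuousLinearMap.integral_apply]
  · rfl
  · exact (integrable_gaussWeight.mul_const C').mono' hcont.aestronglyMeasurable
      (ae_of_all _ fun z => hb z _)

/-- Regularisation: the heat semigroup maps bounded functions to Lipschitz ones. -/
lemma exists_norm_fderiv_heat_le (hφ : Continuous φ) (hC : ∀ x, |φ x| ≤ C) {s : ℝ} (hs : 0 < s) :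
    ∃ C', ∀ x : V, ‖fderiv ℝ (heat s φ) x‖ ≤ C' := by
  have hC0 : 0 ≤ C := (abs_nonneg _).trans (hC 0)
  refine ⟨(√s)⁻¹ * C * ∫ z : V, ‖z‖ * gaussWeight z, fun x => ?_⟩
  have h0 : 0 ≤ ∫ z : V, ‖z‖ * gaussWeight z :=
    integral_nonneg fun z => mul_nonneg (norm_nonneg _) (gaussWeight_pos z).le
  refine ContinuousLinearMap.opNorm_le_bound _ (by positivity) fun v => ?_
  rw [fderiv_heat_apply hφ hC hs]
  refine (norm_integral_le_of_norm_le
    ((integrable_norm_mul_gaussWeight (V := V)).const_mul ((√s)⁻¹ * C * ‖v‖))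
    (ae_of_all _ fun z => ?_)).trans_eq ?_
  · have h1 : ‖⟪z, (√s)⁻¹ • v⟫‖ ≤ ‖z‖ * ((√s)⁻¹ * ‖v‖) := by
      refine (norm_inner_le_norm _ _).trans_eq ?_
      rw [norm_smul, Real.norm_of_nonneg (by positivity)]
    rw [norm_mul, norm_mul, Real.norm_of_nonneg (gaussWeight_pos z).le]
    calc ‖⟪z, (√s)⁻¹ • v⟫‖ * (gaussWeight z * ‖φ (x + √s • z)‖)
        ≤ ‖z‖ * ((√s)⁻¹ * ‖v‖) * (gaussWeight z * C) := by
          refine mul_le_mul h1 (mul_le_mul_of_nonneg_left (hC _) (gaussWeight_pos z).le)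
            (mul_nonneg (gaussWeight_pos z).le (norm_nonneg _)) (by positivity)
      _ = _ := by ring
  · rw [integral_const_mul]; ring

end HeatEquation

section PrekopaLeindler

open scoped ENNReal Pointwise

lemma volume_add_volume_le_of_isCompact {K L : Set ℝ} (hK : IsCompact K) (hL : IsCompact L)
    (hK' : K.Nonempty) (hL' : L.Nonempty) : volume K + volume L ≤ volume (K + L) := by
  have ha := hK.sSup_mem hK'
  have hb := hL.sInf_mem hL'
  set a := sSup K
  set b := sInf L
  have h1 : AEDisjoint volume ((fun x => x + b) '' K) ((fun x => a + x) '' L) := by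
    refine measure_mono_null (t := {a + b}) ?_ (measure_singleton _)
    rintro _ ⟨⟨x, hx, rfl⟩, ⟨y, hy, hxy⟩⟩
    have hxa := le_csSup hK.bddAbove hx
    have hyb := csInf_le hL.bddBelow hy
    simp only at hxy
    simp only [mem_singleton_iff]
    linarith
  have hm : MeasurableSet ((fun x => a + x) '' L) :=
    (hL.image (by fun_prop)).measurableSet
  calc volume K + volume L
      = volume ((fun x => x + b) '' K) + volume ((fun x => a + x) '' L) := by
        simp [image_add_left, image_add_right]
    _ = volume ((fun x => x + b) '' K ∪ (fun x => a + x) '' L) :=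
        (measure_union₀ hm.nullMeasurableSet h1).symm
    _ ≤ volume (K + L) := measure_mono <| by
        rintro _ (⟨x, hx, rfl⟩ | ⟨y, hy, rfl⟩)
        · exact add_mem_add hx hb
        · exact add_mem_add ha hy

/-- One-dimensional Brunn–Minkowski inequality for midpoints. -/
lemma volume_add_volume_le {A B C : Set ℝ} (hA : MeasurableSet A) (hB : MeasurableSet B)
    (hA' : A.Nonempty) (hB' : B.Nonempty)
    (h : ∀ x ∈ A, ∀ y ∈ B, (2⁻¹ : ℝ) • (x + y) ∈ C) : volume A + volume B ≤ 2 * volume C := by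
  obtain ⟨a, ha⟩ := hA'
  obtain ⟨b, hb⟩ := hB'
  have key {K L : Set ℝ} (hK : IsCompact K) (hL : IsCompact L) (hKA : K ⊆ A) (hLB : L ⊆ B) :
      volume K + volume L ≤ 2 * volume C := by
    calc volume K + volume L ≤ volume (insert a K) + volume (insert b L) := by
          gcongr <;> exact subset_insert _ _
      _ ≤ volume (insert a K + insert b L) :=
          volume_add_volume_le_of_isCompact (hK.insert a) (hL.insert b) (insert_nonempty _ _)
            (insert_nonempty _ _)
      _ ≤ volume ((2 : ℝ) • C) := measure_mono <| by
          rintro _ ⟨x, hx, y, hy, rfl⟩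
          rw [mem_smul_set_iff_inv_smul_mem₀ two_ne_zero]
          exact h x (insert_subset ha hKA hx) y (insert_subset hb hLB hy)
      _ = 2 * volume C := by simp [Measure.addHaar_smul]
  rw [hA.measure_eq_iSup_isCompact, hB.measure_eq_iSup_isCompact]
  simp only [iSup_and']
  exact ENNReal.biSup_add_biSup_le' ⟨∅, empty_subset _, isCompact_empty⟩
    ⟨∅, empty_subset _, isCompact_empty⟩ fun K hK L hL => key hK.2 hL.2 hK.1 hL.1

lemma ENNReal.four_mul_mul_le_sq_add (a b : ℝ≥0∞) : 4 * (a * b) ≤ (a + b) ^ 2 := by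
  wlog h : a ≤ b generalizing a b
  · rw [mul_comm a, add_comm]; exact this b a (le_of_not_ge h)
  obtain ⟨c, rfl⟩ := exists_add_of_le h
  calc 4 * (a * (a + c)) ≤ 4 * (a * (a + c)) + c ^ 2 := le_self_add
    _ = (a + (a + c)) ^ 2 := by ring

/-- The midpoint Prékopa–Leindler inequality holds for the measure `m`. -/
def PrekopaLeindler {E : Type} [AddCommGroup E] [Module ℝ E] [MeasurableSpace E]
    (m : Measure E) : Prop :=
  ∀ ⦃f g h : E → ℝ≥0∞⦄, Measurable f → Measurable g → Measurable h →
    (∀ x y, f x * g y ≤ h ((2⁻¹ : ℝ) • (x + y)) ^ 2) →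
    (∫⁻ x, f x ∂m) * ∫⁻ x, g x ∂m ≤ (∫⁻ x, h x ∂m) ^ 2

lemma lintegral_mul_lintegral_le_of_iSup_eq_one {f g h : ℝ → ℝ≥0∞} (hf : Measurable f)
    (hg : Measurable g) (hh : Measurable h) (hf1 : ⨆ x, f x = 1) (hg1 : ⨆ x, g x = 1)
    (hfgh : ∀ x y, f x * g y ≤ h ((2⁻¹ : ℝ) • (x + y)) ^ 2) :
    (∫⁻ x, f x) * ∫⁻ x, g x ≤ (∫⁻ x, h x) ^ 2 := by
  have hf2 (x) : f x ≤ 1 := hf1 ▸ le_iSup f x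
  have hg2 (x) : g x ≤ 1 := hg1 ▸ le_iSup g x
  have layer {k : ℝ → ℝ≥0∞} (hk : Measurable k) (hk2 : ∀ x, k x ≤ 1) :
      ∫⁻ x, k x = ∫⁻ t in Ioo (0 : ℝ) 1, volume {x | ENNReal.ofReal t < k x} := by
    have hfin (x) : k x ≠ ∞ := ((hk2 x).trans_lt ENNReal.one_lt_top).ne
    have h1 := lintegral_eq_lintegral_meas_lt volume (f := fun x => (k x).toReal)
      (ae_of_all _ fun x => ENNReal.toReal_nonneg) hk.ennreal_toReal.aemeasurable
    simp only [ENNReal.ofReal_toReal (hfin _)] at h1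
    rw [h1, ← Ioo_union_Ici_eq_Ioi (zero_lt_one' ℝ), lintegral_union measurableSet_Ici
      (by rw [Set.disjoint_left]; exact fun x hx hx' => not_le.2 hx.2 hx')]
    have h2 : ∫⁻ t in Ici (1 : ℝ), volume {x | t < (k x).toReal} = 0 := by
      rw [setLIntegral_congr_fun (g := fun _ => 0) measurableSet_Ici, lintegral_zero]
      intro t ht
      have : {x | t < (k x).toReal} = ∅ := by
        ext x
        simp only [mem_ofPred_eq, mem_empty_iff_false, iff_false, not_lt]
        exact (ENNReal.toReal_mono ENNReal.one_ne_top (hk2 x)).trans (by simpa using ht)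
      simp [this]
    rw [h2, add_zero]
    refine setLIntegral_congr_fun measurableSet_Ioo fun t ht => ?_
    simp only [ENNReal.ofReal_lt_iff_lt_toReal ht.1.le (hfin _)]
  have hmono {k : ℝ → ℝ≥0∞} : Measurable fun t : ℝ => volume {x | ENNReal.ofReal t < k x} := by
    refine Antitone.measurable fun s t hst => measure_mono fun x hx => ?_
    exact (ENNReal.ofReal_le_ofReal hst).trans_lt hx
  have hne {k : ℝ → ℝ≥0∞} (hk : ⨆ x, k x = 1) {t : ℝ} (ht : t < 1) :
      {x | ENNReal.ofReal t < k x}.Nonempty := by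
    have h1 : ENNReal.ofReal t < ⨆ x, k x := by rw [hk]; simpa using ht
    exact lt_iSup_iff.1 h1
  have key : (∫⁻ x, f x) + ∫⁻ x, g x ≤ 2 * ∫⁻ x, h x := by
    calc (∫⁻ x, f x) + ∫⁻ x, g x ≤ 2 * ∫⁻ x, min (h x) 1 := by
          rw [layer hf hf2, layer hg hg2, layer (hh.min measurable_const) fun x => min_le_right _ _,
            ← lintegral_add_left hmono, ← lintegral_const_mul _ hmono]
          refine setLIntegral_mono' measurableSet_Ioo fun t ht => ?_
          refine volume_add_volume_le (measurableSet_lt measurable_const hf)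
            (measurableSet_lt measurable_const hg) (hne hf1 ht.2) (hne hg1 ht.2) ?_
          intro x hx y hy
          refine lt_min (a := ENNReal.ofReal t) ?_ (by simpa using ht.2)
          refine lt_of_not_ge fun hle => ?_
          refine ((ENNReal.mul_lt_mul hx hy).trans_le (hfgh x y)).not_ge ?_
          rw [← sq]
          gcongr
      _ ≤ 2 * ∫⁻ x, h x := by gcongr; exact min_le_left _ _
  have h4 : 4 * ((∫⁻ x, f x) * ∫⁻ x, g x) ≤ 4 * (∫⁻ x, h x) ^ 2 :=
    (ENNReal.four_mul_mul_le_sq_add _ _).trans <| (pow_le_pow_left₀ zero_le key 2).trans_eq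
      (by ring)
  exact (ENNReal.mul_le_mul_iff_right (by norm_num) (by norm_num)).1 h4

lemma lintegral_mul_lintegral_le_of_bounded {f g h : ℝ → ℝ≥0∞} (hf : Measurable f)
    (hg : Measurable g) (hh : Measurable h) {c : ℝ≥0∞} (hc : c ≠ ∞) (hf1 : ∀ x, f x ≤ c)
    (hg1 : ∀ x, g x ≤ c) (hfgh : ∀ x y, f x * g y ≤ h ((2⁻¹ : ℝ) • (x + y)) ^ 2) :
    (∫⁻ x, f x) * ∫⁻ x, g x ≤ (∫⁻ x, h x) ^ 2 := by
  set a := ⨆ x, f x with ha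
  set b := ⨆ x, g x with hb
  have ha1 : a ≠ ∞ := ((iSup_le hf1).trans_lt hc.lt_top).ne
  have hb1 : b ≠ ∞ := ((iSup_le hg1).trans_lt hc.lt_top).ne
  by_cases ha0 : a = 0
  · have : f = 0 := funext fun x => le_antisymm ((le_iSup f x).trans_eq ha0) zero_le
    simp [this]
  by_cases hb0 : b = 0
  · have : g = 0 := funext fun x => le_antisymm ((le_iSup g x).trans_eq hb0) zero_le
    simp [this]
  set d : ℝ≥0∞ := (a * b) ^ (1 / 2 : ℝ) with hd
  have hd2 : d ^ 2 = a * b := by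
    rw [hd, ← ENNReal.rpow_natCast, ← ENNReal.rpow_mul]; norm_num
  have hab0 : a * b ≠ 0 := mul_ne_zero ha0 hb0
  have hab1 : a * b ≠ ∞ := ENNReal.mul_ne_top ha1 hb1
  have hk := lintegral_mul_lintegral_le_of_iSup_eq_one (f := fun x => a⁻¹ * f x)
    (g := fun x => b⁻¹ * g x) (h := fun x => d⁻¹ * h x) (hf.const_mul _) (hg.const_mul _)
    (hh.const_mul _) (by rw [← ENNReal.mul_iSup, ← ha, ENNReal.inv_mul_cancel ha0 ha1])
    (by rw [← ENNReal.mul_iSup, ← hb, ENNReal.inv_mul_cancel hb0 hb1]) ?_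
  · rw [lintegral_const_mul _ hf, lintegral_const_mul _ hg, lintegral_const_mul _ hh, mul_pow,
      ← ENNReal.inv_pow, hd2, mul_mul_mul_comm, ← ENNReal.mul_inv (.inl ha0) (.inl ha1)] at hk
    exact (ENNReal.mul_le_mul_iff_right (ENNReal.inv_ne_zero.2 hab1)
      (ENNReal.inv_ne_top.2 hab0)).1 hk
  · intro x y
    rw [mul_pow, ← ENNReal.inv_pow, hd2, mul_mul_mul_comm, ← ENNReal.mul_inv (.inl ha0) (.inl ha1)]
    gcongr
    exact hfgh x y

lemma prekopaLeindler_real : PrekopaLeindler (volume : Measure ℝ) := by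
  intro f g h hf hg hh hfgh
  have hlim {k : ℝ → ℝ≥0∞} (hk : Measurable k) :
      ∫⁻ x, k x = ⨆ n : ℕ, ∫⁻ x, min (k x) n := by
    rw [← lintegral_iSup (fun n => hk.min measurable_const)
      fun m n hmn x => min_le_min_left _ (by exact_mod_cast hmn)]
    congr 1; funext x
    rw [← inf_iSup_eq, ENNReal.iSup_natCast, inf_top_eq]
  rw [hlim hf, hlim hg]
  simp only [ENNReal.iSup_mul, ENNReal.mul_iSup]
  refine iSup_le fun i => iSup_le fun j => ?_
  refine (mul_le_mul' (lintegral_mono fun x => min_le_min_left _ ?_)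
    (lintegral_mono fun x => min_le_min_left _ ?_)).trans
    (lintegral_mul_lintegral_le_of_bounded (hf.min measurable_const) (hg.min measurable_const) hh
      (c := (max i j : ℕ)) (ENNReal.natCast_ne_top _) (fun x => min_le_right _ _)
      (fun x => min_le_right _ _) fun x y => ?_)
  · exact_mod_cast le_max_right i j
  · exact_mod_cast le_max_left i j
  · exact (mul_le_mul' (min_le_left _ _) (min_le_left _ _)).trans (hfgh x y)

lemma PrekopaLeindler.prod {E F : Type} [AddCommGroup E] [Module ℝ E] [MeasurableSpace E]
    [AddCommGroup F] [Module ℝ F] [MeasurableSpace F] {m : Measure E} {m' : Measure F} [SFinite m']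
    (hm : PrekopaLeindler m) (hm' : PrekopaLeindler m') : PrekopaLeindler (m.prod m') := by
  intro f g h hf hg hh hfgh
  rw [lintegral_prod _ hf.aemeasurable, lintegral_prod _ hg.aemeasurable,
    lintegral_prod _ hh.aemeasurable]
  refine hm hf.lintegral_prod_right' hg.lintegral_prod_right' hh.lintegral_prod_right'
    fun x y => ?_
  refine hm' (hf.comp measurable_prodMk_left) (hg.comp measurable_prodMk_left)
    (hh.comp measurable_prodMk_left) fun z w => ?_
  exact hfgh (x, z) (y, w)

lemma PrekopaLeindler.of_measurePreserving {E F : Type} [AddCommGroup E] [Module ℝ E]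
    [MeasurableSpace E] [AddCommGroup F] [Module ℝ F] [MeasurableSpace F] {m : Measure E}
    {m' : Measure F} (hm : PrekopaLeindler m) {e : E → F} (he : MeasurePreserving e m m')
    (he' : ∀ x y, e ((2⁻¹ : ℝ) • (x + y)) = (2⁻¹ : ℝ) • (e x + e y)) : PrekopaLeindler m' := by
  intro f g h hf hg hh hfgh
  rw [← he.lintegral_comp hf, ← he.lintegral_comp hg, ← he.lintegral_comp hh]
  refine hm (hf.comp he.measurable) (hg.comp he.measurable) (hh.comp he.measurable) fun x y => ?_
  simp only [he']
  exact hfgh _ _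

lemma prekopaLeindler_pi (n : ℕ) : PrekopaLeindler (volume : Measure (Fin n → ℝ)) := by
  induction n with
  | zero =>
    intro f g h hf hg hh hfgh
    have h1 := hfgh default default
    rw [Subsingleton.elim ((2⁻¹ : ℝ) • ((default : Fin 0 → ℝ) + default)) default] at h1
    rw [lintegral_unique, lintegral_unique, lintegral_unique]
    have h2 : (volume : Measure (Fin 0 → ℝ)) univ = 1 := by simp [volume_pi]
    rw [h2, mul_one, mul_one, mul_one]
    convert! h1
  | succ n ih =>
    exact (prekopaLeindler_real.prod ih).of_measurePreserving
      ((volume_preserving_piFinSuccAbove (fun _ => ℝ) 0).symm _) fun x y => by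
        funext i
        refine Fin.cases ?_ (fun j => ?_) i <;>
        simp [MeasurableEquiv.piFinSuccAbove, mul_add]

lemma prekopaLeindler_euclideanSpace (n : ℕ) :
    PrekopaLeindler (volume : Measure (EuclideanSpace ℝ (Fin n))) :=
  (prekopaLeindler_pi n).of_measurePreserving (PiLp.volume_preserving_toLp (Fin n))
    fun _ _ => rfl

end PrekopaLeindler

section LogConcave

/-- Midpoint log-concavity of a nonnegative function. -/
def MidLogConcave {V : Type} [AddCommGroup V] (G : V → ℝ) : Prop :=
  ∀ x h, G (x + h) * G (x - h) ≤ G x ^ 2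

lemma midLogConcave_gaussWeight {V : Type} [NormedAddCommGroup V] [InnerProductSpace ℝ V]
    [FiniteDimensional ℝ V] [MeasurableSpace V] [BorelSpace V] :
    MidLogConcave (gaussWeight : V → ℝ) := by
  intro x h
  have h0 := integral_exp_neg_sq_norm_div_two_pos (V := V)
  unfold gaussWeight
  rw [div_mul_div_comm, div_pow, ← sq (∫ y : V, Real.exp (-‖y‖ ^ 2 / 2))]
  gcongr
  rw [← Real.exp_add, ← Real.exp_nat_mul, Real.exp_le_exp]
  have := parallelogram_law_with_norm ℝ x h
  push_cast
  nlinarith [sq_nonneg ‖h‖]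

lemma MidLogConcave.heat {n : ℕ} {G : EuclideanSpace ℝ (Fin n) → ℝ} {C : ℝ}
    (hG : MidLogConcave G) (hc : Continuous G) (hC : ∀ x, |G x| ≤ C) (h0 : ∀ x, 0 ≤ G x) (s : ℝ) :
    MidLogConcave (heat s G) := by
  intro x h
  let F (x z : EuclideanSpace ℝ (Fin n)) : ℝ := gaussWeight z * G (x + √s • z)
  have hF0 (x z) : 0 ≤ F x z := mul_nonneg (gaussWeight_pos z).le (h0 _)
  have hFm (x) : Measurable fun z => ENNReal.ofReal (F x z) :=
    (continuous_gaussWeight.mul (hc.comp (by fun_prop))).measurable.ennreal_ofReal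
  have hFi (x) : ∫⁻ z, ENNReal.ofReal (F x z) = ENNReal.ofReal (_root_.heat s G x) :=
    (ofReal_integral_eq_lintegral_ofReal (integrable_heat hc hC s x)
      (ae_of_all _ (hF0 x))).symm
  have hpos (x) : 0 ≤ _root_.heat s G x := integral_nonneg (hF0 x)
  have key := prekopaLeindler_euclideanSpace n (hFm (x + h)) (hFm (x - h)) (hFm x) fun z w => by
    rw [← ENNReal.ofReal_mul (hF0 _ _), ← ENNReal.ofReal_pow (hF0 _ _)]
    refine ENNReal.ofReal_le_ofReal ?_
    set p : EuclideanSpace ℝ (Fin n) := (2⁻¹ : ℝ) • (z + w)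
    set q : EuclideanSpace ℝ (Fin n) := (2⁻¹ : ℝ) • (z - w)
    have hz : z = p + q := by simp only [p, q]; module
    have hw : w = p - q := by simp only [p, q]; module
    have h1 := midLogConcave_gaussWeight p q
    have h2 := hG (x + √s • p) (h + √s • q)
    have e1 : x + √s • p + (h + √s • q) = x + h + √s • z := by rw [hz]; module
    have e2 : x + √s • p - (h + √s • q) = x - h + √s • w := by rw [hw]; module
    rw [e1, e2] at h2
    rw [← hz, ← hw] at h1
    calc F (x + h) z * F (x - h) w
        = gaussWeight z * gaussWeight w * (G (x + h + √s • z) * G (x - h + √s • w)) := by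
          simp only [F]; ring
      _ ≤ gaussWeight p ^ 2 * G (x + √s • p) ^ 2 :=
          mul_le_mul h1 h2 (mul_nonneg (h0 _) (h0 _)) (sq_nonneg _)
      _ = F x p ^ 2 := by simp only [F]; ring
  rw [hFi, hFi, hFi, ← ENNReal.ofReal_mul (hpos _), ← ENNReal.ofReal_pow (hpos _),
    ENNReal.ofReal_le_ofReal_iff (sq_nonneg _)] at key
  exact key

end LogConcave

section SecondOrder

lemma second_deriv_nonneg_of_isLocalMin {q q₁ : ℝ → ℝ} {q₂ : ℝ}
    (h₁ : ∀ᶠ r in 𝓝 0, HasDerivAt q (q₁ r) r) (h₂ : HasDerivAt q₁ q₂ 0)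
    (hmin : IsLocalMin q 0) : 0 ≤ q₂ := by
  by_contra! hneg
  have hd : deriv q =ᶠ[𝓝 0] q₁ := h₁.mono fun r hr => hr.deriv
  have hdd : deriv (deriv q) 0 = q₂ := hd.deriv_eq.trans h₂.deriv
  have hmax := isLocalMax_of_deriv_deriv_neg (by rwa [hdd]) hmin.deriv_eq_zero
    h₁.self_of_nhds.continuousAt
  have hconst : q =ᶠ[𝓝 0] fun _ => q 0 := by
    filter_upwards [hmin, hmax] with r h h' using le_antisymm h' h
  have h0 : deriv q =ᶠ[𝓝 0] fun _ => 0 := hconst.deriv.trans (by simp)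
  have h3 := h0.deriv_eq
  rw [hdd, deriv_const] at h3
  exact hneg.ne h3

lemma HasDerivAt.nonneg_of_forall_ge {q : ℝ → ℝ} {q₁ t T : ℝ} (h : HasDerivAt q q₁ t)
    (htT : t < T) (hq : ∀ τ ∈ Icc t T, q t ≤ q τ) : 0 ≤ q₁ := by
  refine ge_of_tendsto h.tendsto_slope_zero_right ?_
  filter_upwards [Ioo_mem_nhdsGT (sub_pos.2 htT)] with r hr
  have := hq (t + r) ⟨by linarith [hr.1], by linarith [hr.2]⟩
  exact mul_nonneg (inv_nonneg.2 hr.1.le) (sub_nonneg.2 this)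

lemma mul_le_sq_of_forall_mul_neg_le {p p₁ : ℝ → ℝ} {p₂ : ℝ} (h₁ : ∀ r, HasDerivAt p (p₁ r) r)
    (h₂ : HasDerivAt p₁ p₂ 0) (hp : ∀ r, p r * p (-r) ≤ p 0 ^ 2) : p 0 * p₂ ≤ p₁ 0 ^ 2 := by
  have hneg {k : ℝ → ℝ} {k' r : ℝ} (hk : HasDerivAt k k' (-r)) :
      HasDerivAt (fun r => k (-r)) (-k') r :=
    (hk.comp r (hasDerivAt_neg r)).congr_deriv (by simp)
  have hq₁ (r : ℝ) : HasDerivAt (fun r => p 0 ^ 2 - p r * p (-r))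
      (-(p₁ r * p (-r) + p r * -p₁ (-r))) r :=
    ((h₁ r).mul (hneg (h₁ _))).const_sub _
  have h₂' : HasDerivAt p₁ p₂ (-0) := by simpa using h₂
  have hq₂ := ((h₂.mul (hneg (h₁ _))).fun_add ((h₁ 0).mul (hneg h₂').fun_neg)).fun_neg
  have := second_deriv_nonneg_of_isLocalMin (Eventually.of_forall hq₁) hq₂
    (Eventually.of_forall fun r => by
      have := hp r
      simp only [neg_zero]
      nlinarith)
  simp only [neg_zero] at this
  nlinarith

end SecondOrder

section ParabolicJet

variable {V : Type} [NormedAddCommGroup V] [InnerProductSpace ℝ V] {ι : Type}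

/-- First time derivative, and first and second derivatives in the directions `b i`, of a function
of time and space at a point. -/
structure HasParabolicJet (b : ι → V) (w : ℝ → V → ℝ) (t : ℝ) (x : V) (wt : ℝ)
    (w₁ w₂ : ι → ℝ) : Prop where
  time : HasDerivAt (fun τ => w τ x) wt t
  space : ∀ i, ∃ d : ℝ → ℝ, d 0 = w₁ i ∧ (∀ r, HasDerivAt (fun r => w t (x + r • b i)) (d r) r) ∧
    HasDerivAt d (w₂ i) 0

variable {b : ι → V} {t : ℝ} {x : V}

lemma HasParabolicJet.sub {w z : ℝ → V → ℝ} {wt zt : ℝ} {w₁ w₂ z₁ z₂ : ι → ℝ}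
    (hw : HasParabolicJet b w t x wt w₁ w₂) (hz : HasParabolicJet b z t x zt z₁ z₂) :
    HasParabolicJet b (fun t x => w t x - z t x) t x (wt - zt) (w₁ - z₁) (w₂ - z₂) where
  time := hw.time.sub hz.time
  space i := by
    obtain ⟨d, hd0, hd, hd'⟩ := hw.space i
    obtain ⟨e, he0, he, he'⟩ := hz.space i
    exact ⟨fun r => d r - e r, by simp [hd0, he0], fun r => (hd r).sub (he r), hd'.sub he'⟩

lemma HasParabolicJet.add {w z : ℝ → V → ℝ} {wt zt : ℝ} {w₁ w₂ z₁ z₂ : ι → ℝ}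
    (hw : HasParabolicJet b w t x wt w₁ w₂) (hz : HasParabolicJet b z t x zt z₁ z₂) :
    HasParabolicJet b (fun t x => w t x + z t x) t x (wt + zt) (w₁ + z₁) (w₂ + z₂) where
  time := hw.time.add hz.time
  space i := by
    obtain ⟨d, hd0, hd, hd'⟩ := hw.space i
    obtain ⟨e, he0, he, he'⟩ := hz.space i
    exact ⟨fun r => d r + e r, by simp [hd0, he0], fun r => (hd r).add (he r), hd'.add he'⟩

lemma HasParabolicJet.nonneg_of_min [Fintype ι] {w : ℝ → V → ℝ} {wt : ℝ} {w₁ w₂ : ι → ℝ}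
    (hw : HasParabolicJet b w t x wt w₁ w₂) {T : ℝ} (htT : t < T)
    (hmin_t : ∀ τ ∈ Icc t T, w t x ≤ w τ x) (hmin_x : ∀ᶠ y in 𝓝 x, w t x ≤ w t y) :
    0 ≤ wt + 1 / 2 * ∑ i, w₂ i := by
  have h1 := hw.time.nonneg_of_forall_ge htT hmin_t
  have h2 (i : ι) : 0 ≤ w₂ i := by
    obtain ⟨d, -, hd, hd'⟩ := hw.space i
    refine second_deriv_nonneg_of_isLocalMin (Eventually.of_forall hd) hd' ?_
    have hc : Tendsto (fun r : ℝ => x + r • b i) (𝓝 0) (𝓝 x) := by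
      have : Continuous fun r : ℝ => x + r • b i := by fun_prop
      simpa using this.tendsto 0
    filter_upwards [hc.eventually hmin_x] with r hr
    simpa using hr
  have := Finset.sum_nonneg fun i (_ : i ∈ Finset.univ) => h2 i
  linarith

lemma hasParabolicJet_sq_norm_add (c T : ℝ) (hb : ∀ i, ‖b i‖ = 1) (a : ℝ) :
    HasParabolicJet b (fun t x => a * (‖x‖ ^ 2 + c * (T - t))) t x (-(a * c))
      (fun i => a * (2 * ⟪x, b i⟫)) (fun _ => 2 * a) where
  time := by
    have := ((((hasDerivAt_id t).const_sub T).const_mul c).const_add (‖x‖ ^ 2)).const_mul a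
    convert! this using 1
    ring
  space i := by
    refine ⟨fun r => a * (2 * ⟪x, b i⟫ + 2 * r), by simp, fun r => ?_, ?_⟩
    · have h1 : (fun r : ℝ => a * (‖x + r • b i‖ ^ 2 + c * (T - t))) =
          fun r => a * (‖x‖ ^ 2 + 2 * (r * ⟪x, b i⟫) + r ^ 2 + c * (T - t)) := by
        funext r
        rw [norm_add_sq_real, inner_smul_right, norm_smul, hb, mul_one, Real.norm_eq_abs, sq_abs]
      rw [h1]
      have h2 : HasDerivAt (fun r : ℝ => r ^ 2) (2 * r) r := by simpa using hasDerivAt_pow 2 r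
      exact ((((((hasDerivAt_id r).mul_const ⟪x, b i⟫).const_mul 2).const_add (‖x‖ ^ 2)).add
        h2).add_const (c * (T - t))).const_mul a |>.congr_deriv (by simp)
    · have := (((hasDerivAt_id (0 : ℝ)).const_mul 2).const_add (2 * ⟪x, b i⟫)).const_mul a
      exact this.congr_deriv (by ring)

end ParabolicJet

section Minorant

variable {p q P Q p₁ q₁ P₁ Q₁ : ℝ → ℝ} {p' q' P' Q' p₂ q₂ P₂ Q₂ r : ℝ}

lemma HasDerivAt.div_eq (hp : HasDerivAt p p' r) (hq : HasDerivAt q q' r) (h0 : p r ≠ 0) :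
    HasDerivAt (fun r => q r / p r) ((q' - q r / p r * p') / p r) r := by
  refine (hq.div hp h0).congr_deriv ?_
  field_simp

lemma HasDerivAt.mul_isoI_div (hp : HasDerivAt p p' r) (hq : HasDerivAt q q' r)
    (h0 : 0 < q r) (h1 : q r < p r) :
    HasDerivAt (fun r => p r * isoI (q r / p r))
      (p' * isoI (q r / p r) - PhiInv (q r / p r) * (q' - q r / p r * p')) r := by
  have hpr : 0 < p r := h0.trans h1
  have hI := (hasDerivAt_isoI (div_pos h0 hpr) ((div_lt_one hpr).2 h1)).comp r
    (hp.div_eq hq hpr.ne')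
  refine (hp.mul hI).congr_deriv ?_
  simp only [Function.comp_apply]
  field_simp
  ring

lemma HasDerivAt.sub_div_mul (hp : HasDerivAt p p' r) (hq : HasDerivAt q q' r)
    (hP : HasDerivAt P P' r) (hQ : HasDerivAt Q Q' r) (h0 : p r ≠ 0) :
    HasDerivAt (fun r => Q r - q r / p r * P r)
      (Q' - (q' - q r / p r * p') / p r * P r - q r / p r * P') r :=
  (hQ.fun_sub ((hp.div_eq hq h0).fun_mul hP)).congr_deriv (by ring)

lemma HasDerivAt.deriv_mul_isoI_div (hp : HasDerivAt p (p₁ r) r) (hq : HasDerivAt q (q₁ r) r)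
    (hp₁ : HasDerivAt p₁ p₂ r) (hq₁ : HasDerivAt q₁ q₂ r) (h0 : 0 < q r) (h1 : q r < p r) :
    HasDerivAt (fun r => p₁ r * isoI (q r / p r) -
        PhiInv (q r / p r) * (q₁ r - q r / p r * p₁ r))
      (p₂ * isoI (q r / p r) - (isoI (q r / p r))⁻¹ * ((q₁ r - q r / p r * p₁ r) ^ 2 / p r) -
        PhiInv (q r / p r) * (q₂ - q r / p r * p₂)) r := by
  have hpr : 0 < p r := h0.trans h1
  have hρ := hp.div_eq hq hpr.ne'
  have hρ0 := div_pos h0 hpr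
  have hρ1 := (div_lt_one hpr).2 h1
  have hI := (hasDerivAt_isoI hρ0 hρ1).comp r hρ
  have hJ := (hasDerivAt_PhiInv hρ0 hρ1).comp r hρ
  have hI0 := (isoI_pos (q r / p r)).ne'
  refine ((hp₁.mul hI).sub (hJ.mul (hq₁.sub (hρ.mul hp₁)))).congr_deriv ?_
  simp only [Function.comp_apply, Pi.sub_apply, Pi.mul_apply]
  field_simp
  ring

lemma HasDerivAt.deriv_sub_div_mul (hp : HasDerivAt p (p₁ r) r) (hq : HasDerivAt q (q₁ r) r)
    (hP : HasDerivAt P (P₁ r) r) (hp₁ : HasDerivAt p₁ p₂ r) (hq₁ : HasDerivAt q₁ q₂ r)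
    (hP₁ : HasDerivAt P₁ P₂ r) (hQ₁ : HasDerivAt Q₁ Q₂ r) (h0 : p r ≠ 0) :
    HasDerivAt (fun r => Q₁ r - (q₁ r - q r / p r * p₁ r) / p r * P r - q r / p r * P₁ r)
      (Q₂ - q r / p r * P₂ - (q₂ - q r / p r * p₂) * (P r / p r) -
        2 * ((q₁ r - q r / p r * p₁ r) / p r * P₁ r) +
        2 * ((q₁ r - q r / p r * p₁ r) / p r * p₁ r) * (P r / p r)) r := by
  have hρ := hp.div_eq hq h0
  refine ((hQ₁.fun_sub (((hq₁.fun_sub (hρ.fun_mul hp₁)).fun_div hp h0).fun_mul hP)).fun_sub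
    (hρ.fun_mul hP₁)).congr_deriv ?_
  field_simp
  ring

end Minorant

section MinorantJet

variable {V : Type} [NormedAddCommGroup V] [InnerProductSpace ℝ V] {ι : Type} {b : ι → V} {t : ℝ}
  {x : V} {p q P Q : ℝ → V → ℝ} {pt qt Pt Qt : ℝ} {p₁ q₁ P₁ Q₁ p₂ q₂ P₂ Q₂ : ι → ℝ}

/-- The affine minorant of `√((p I(q/p))² + t |Q - (q/p) P|²)`. -/
noncomputable def minorant (a c : ℝ) (p q P Q : ℝ → V → ℝ) (t : ℝ) (x : V) : ℝ :=
  (a * (p t x * isoI (q t x / p t x)) + t * (Q t x - q t x / p t x * P t x)) / √(a ^ 2 + t * c)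

lemma HasParabolicJet.minorant (hp : HasParabolicJet b p t x pt p₁ p₂)
    (hq : HasParabolicJet b q t x qt q₁ q₂) (hP : HasParabolicJet b P t x Pt P₁ P₂)
    (hQ : HasParabolicJet b Q t x Qt Q₁ Q₂) (h0 : ∀ t x, 0 < q t x) (h1 : ∀ t x, q t x < p t x)
    {a c ρ S : ℝ} (hρ : q t x / p t x = ρ) (hS : √(a ^ 2 + t * c) = S) (hS0 : 0 < S) :
    ∃ N₁, HasParabolicJet b (minorant a c p q P Q) t x
      ((a * (pt * isoI ρ - PhiInv ρ * (qt - ρ * pt)) + (Q t x - ρ * P t x +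
          t * (Qt - (qt - ρ * pt) / p t x * P t x - ρ * Pt))) / S -
        (a * (p t x * isoI ρ) + t * (Q t x - ρ * P t x)) * (c / (2 * S)) / S ^ 2) N₁
      (fun i => (a * (p₂ i * isoI ρ - (isoI ρ)⁻¹ * ((q₁ i - ρ * p₁ i) ^ 2 / p t x) -
          PhiInv ρ * (q₂ i - ρ * p₂ i)) +
        t * (Q₂ i - ρ * P₂ i - (q₂ i - ρ * p₂ i) * (P t x / p t x) -
          2 * ((q₁ i - ρ * p₁ i) / p t x * P₁ i) +
          2 * ((q₁ i - ρ * p₁ i) / p t x * p₁ i) * (P t x / p t x))) / S) := by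
  have hp0 (t x) : p t x ≠ 0 := ((h0 t x).trans (h1 t x)).ne'
  have hsq : a ^ 2 + t * c ≠ 0 := by
    rintro h; rw [h, Real.sqrt_zero] at hS; exact hS0.ne hS
  refine ⟨fun i => (a * (p₁ i * isoI ρ - PhiInv ρ * (q₁ i - ρ * p₁ i)) +
    t * (Q₁ i - (q₁ i - ρ * p₁ i) / p t x * P t x - ρ * P₁ i)) / S, ?_, fun i => ?_⟩
  · have hSd : HasDerivAt (fun t : ℝ => √(a ^ 2 + t * c)) (c / (2 * S)) t := by
      have := (((hasDerivAt_id t).mul_const c).const_add (a ^ 2)).sqrt hsq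
      simpa [hS] using this
    have hnum := ((hp.time.mul_isoI_div hq.time (h0 t x) (h1 t x)).const_mul a).fun_add
      ((hasDerivAt_id t).fun_mul (hp.time.sub_div_mul hq.time hP.time hQ.time (hp0 t x)))
    refine (hnum.fun_div hSd (by rw [hS]; exact hS0.ne')).congr_deriv ?_
    simp only [hρ, hS, id]
    field_simp
  · obtain ⟨dp, hp0', hpd, hpd'⟩ := hp.space i
    obtain ⟨dq, hq0', hqd, hqd'⟩ := hq.space i
    obtain ⟨dP, hP0', hPd, hPd'⟩ := hP.space i
    obtain ⟨dQ, hQ0', hQd, hQd'⟩ := hQ.space i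
    refine ⟨_, ?_, fun r => ((((hpd r).mul_isoI_div (hqd r) (h0 _ _) (h1 _ _)).const_mul a).fun_add
      (((hpd r).sub_div_mul (hqd r) (hPd r) (hQd r) (hp0 _ _)).const_mul t)).div_const _, ?_⟩
    · simp only [hp0', hq0', hP0', hQ0', zero_smul, add_zero, hρ, hS]
    · refine (((((hpd 0).deriv_mul_isoI_div (hqd 0) hpd' hqd' (h0 _ _) (h1 _ _)).const_mul
        a).fun_add (((hpd 0).deriv_sub_div_mul (hqd 0) (hPd 0) hpd' hqd' hPd' hQd'
        (hp0 _ _)).const_mul t)).div_const _).congr_deriv ?_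
      simp only [hp0', hq0', hP0', zero_smul, add_zero, hρ, hS]

end MinorantJet

section HeatOrder

variable {V : Type} [NormedAddCommGroup V] [InnerProductSpace ℝ V] [FiniteDimensional ℝ V]
  [MeasurableSpace V] [BorelSpace V] {φ ψ : V → ℝ} {C C' : ℝ}

lemma heat_zero (φ : V → ℝ) (x : V) : heat 0 φ x = φ x := by
  simp [heat, integral_mul_const, integral_gaussWeight]

lemma heat_pos (hφ : Continuous φ) (hC : ∀ x, |φ x| ≤ C) (h : ∀ x, 0 < φ x) (s : ℝ) (x : V) :
    0 < heat s φ x := by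
  have hpos (z : V) : 0 < gaussWeight z * φ (x + √s • z) := mul_pos (gaussWeight_pos z) (h _)
  refine (integral_pos_iff_support_of_nonneg (fun z => (hpos z).le)
    (integrable_heat hφ hC s x)).2 ?_
  rw [show Function.support _ = univ from eq_univ_of_forall fun z => (hpos z).ne']
  exact Measure.measure_univ_pos.2 (NeZero.ne _)

lemma heat_lt (hφ : Continuous φ) (hC : ∀ x, |φ x| ≤ C) (hψ : Continuous ψ)
    (hC' : ∀ x, |ψ x| ≤ C') (h : ∀ x, φ x < ψ x) (s : ℝ) (x : V) : heat s φ x < heat s ψ x := by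
  have h1 := heat_pos (φ := fun x => ψ x - φ x) (C := C' + C) (hψ.sub hφ)
    (fun x => (abs_sub _ _).trans (add_le_add (hC' x) (hC x))) (fun x => sub_pos.2 (h x)) s x
  have h2 : heat s (fun x => ψ x - φ x) x = heat s ψ x - heat s φ x := by
    unfold heat
    rw [← integral_sub (integrable_heat hψ hC' s x) (integrable_heat hφ hC s x)]
    congr 1; funext z; ring
  linarith

lemma hasParabolicJet_heat {ι : Type} [Fintype ι] (b : OrthonormalBasis ι ℝ V)
    (hφ : Continuous φ) (hC : ∀ x, |φ x| ≤ C) {t T : ℝ} (ht : t < T) (x : V) :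
    HasParabolicJet b (fun t => heat (T - t) φ) t x
      (-(1 / 2 * ∑ i, fderiv ℝ (fun y => fderiv ℝ (heat (T - t) φ) y (b i)) x (b i)))
      (fun i => fderiv ℝ (heat (T - t) φ) x (b i))
      (fun i => fderiv ℝ (fun y => fderiv ℝ (heat (T - t) φ) y (b i)) x (b i)) where
  time := by
    have h1 := hasDerivAt_heat b hφ hC (sub_pos.2 ht) x
    exact (h1.comp t ((hasDerivAt_id t).const_sub T)).congr_deriv (by ring)
  space i := ⟨fun r => fderiv ℝ (heat (T - t) φ) (x + r • b i) (b i), by simp,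
    hasDerivAt_heat_line hφ hC (sub_pos.2 ht) x (b i), by
      simpa using hasDerivAt_fderiv_heat_line hφ hC (sub_pos.2 ht) x (b i) (b i) 0⟩

/-- Second-order consequence of the log-concavity of a caloric function. -/
lemma heat_mul_fderiv_fderiv_le (hφ : Continuous φ) (hC : ∀ x, |φ x| ≤ C) {s : ℝ} (hs : 0 < s)
    (hlog : MidLogConcave (heat s φ)) (x v : V) :
    heat s φ x * fderiv ℝ (fun y => fderiv ℝ (heat s φ) y v) x v ≤ fderiv ℝ (heat s φ) x v ^ 2 := by
  have h := mul_le_sq_of_forall_mul_neg_le (hasDerivAt_heat_line hφ hC hs x v)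
    (hasDerivAt_fderiv_heat_line hφ hC hs x v v 0) fun r => by
      simpa [sub_eq_add_neg] using hlog x (r • v)
  simpa using h

end HeatOrder

lemma caloric_minorant_nonneg {ι : Type} [Fintype ι] {p₁ q₁ P₁ p₂ q₂ P₂ Q₂ c : ι → ℝ}
    {p P D t ρ J S I A : ℝ} (hp : 0 < p) (hI : 0 < I) (hS0 : 0 < S) (ht : 0 ≤ t)
    (hS : S ^ 2 = I ^ 2 + t * A) (hA : ∑ i, c i ^ 2 = A) (hc : ∀ i, q₁ i - ρ * p₁ i = p * c i)
    (hD : D = p * A) (hP : ∑ i, c i * p₁ i = P) (hlog : p * ∑ i, c i * P₁ i ≤ P ^ 2) :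
    0 ≤ ((I * (-(1 / 2 * ∑ i, p₂ i) * I - J * (-(1 / 2 * ∑ i, q₂ i) - ρ * -(1 / 2 * ∑ i, p₂ i))) +
        (D + t * (-(1 / 2 * ∑ i, Q₂ i) - (-(1 / 2 * ∑ i, q₂ i) - ρ * -(1 / 2 * ∑ i, p₂ i)) / p * P -
          ρ * -(1 / 2 * ∑ i, P₂ i)))) / S -
        (I * (p * I) + t * D) * (A / (2 * S)) / S ^ 2) +
      1 / 2 * ∑ i, (I * (p₂ i * I - I⁻¹ * ((q₁ i - ρ * p₁ i) ^ 2 / p) - J * (q₂ i - ρ * p₂ i)) +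
        t * (Q₂ i - ρ * P₂ i - (q₂ i - ρ * p₂ i) * (P / p) - 2 * ((q₁ i - ρ * p₁ i) / p * P₁ i) +
          2 * ((q₁ i - ρ * p₁ i) / p * p₁ i) * (P / p))) / S := by
  have h1 : ∑ i, (I * (p₂ i * I - I⁻¹ * ((q₁ i - ρ * p₁ i) ^ 2 / p) - J * (q₂ i - ρ * p₂ i)) +
        t * (Q₂ i - ρ * P₂ i - (q₂ i - ρ * p₂ i) * (P / p) - 2 * ((q₁ i - ρ * p₁ i) / p * P₁ i) +
          2 * ((q₁ i - ρ * p₁ i) / p * p₁ i) * (P / p))) / S =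
      (I * ((∑ i, p₂ i) * I - I⁻¹ * (p * A) - J * ((∑ i, q₂ i) - ρ * ∑ i, p₂ i)) +
        t * ((∑ i, Q₂ i) - ρ * (∑ i, P₂ i) - ((∑ i, q₂ i) - ρ * ∑ i, p₂ i) * (P / p) -
          2 * (∑ i, c i * P₁ i) + 2 * P * (P / p))) / S := by
    rw [← Finset.sum_div, ← hA, ← hP]
    congr 1
    simp only [hc, Finset.sum_add_distrib, Finset.sum_sub_distrib, ← Finset.mul_sum,
      ← Finset.sum_mul]
    have e1 : ∑ i, (p * c i) ^ 2 / p = p * ∑ i, c i ^ 2 := by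
      rw [Finset.mul_sum]; exact Finset.sum_congr rfl fun i _ => by field_simp
    have e2 (k : ι → ℝ) : ∑ i, p * c i / p * k i = ∑ i, c i * k i :=
      Finset.sum_congr rfl fun i _ => by field_simp
    rw [e1, e2, e2]
  rw [h1, hD]
  generalize ∑ i, c i * P₁ i = B at *
  have h2 : 0 ≤ t / S * ((P ^ 2 - p * B) / p) :=
    mul_nonneg (div_nonneg ht hS0.le) (div_nonneg (sub_nonneg.2 hlog) hp.le)
  refine h2.trans_eq ?_
  have h3 : (I * (p * I) + t * (p * A)) * (A / (2 * S)) / S ^ 2 = p * A / (2 * S) := by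
    rw [show I * (p * I) + t * (p * A) = p * S ^ 2 by rw [hS]; ring]
    field_simp
  rw [h3]
  field_simp
  ring

section Functional

variable {V : Type} {ι : Type} [Fintype ι]

/-- The functional `√((p I(q/p))² + t ∑ⱼ (q'ⱼ - (q/p) p'ⱼ)²)`. -/
noncomputable def bobkovFunctional (t p q : ℝ) (p' q' : ι → ℝ) : ℝ :=
  √((p * isoI (q / p)) ^ 2 + t * ∑ j, (q' j - q / p * p' j) ^ 2)

variable {t p q : ℝ} {p' q' : ι → ℝ}

lemma bobkovFunctional_zero (hp : 0 < p) :
    bobkovFunctional 0 p q p' q' = p * isoI (q / p) := by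
  rw [bobkovFunctional, zero_mul, add_zero, Real.sqrt_sq (mul_pos hp (isoI_pos _)).le]

lemma isoI_le_one (y : ℝ) : isoI y ≤ 1 := gaussPDF_le_one _

lemma bobkovFunctional_le {T C D : ℝ} (ht : 0 ≤ t) (htT : t ≤ T) (hp : 0 < p) (hq : 0 < q)
    (hqp : q < p) (hpC : p ≤ C) (hp' : ∀ j, |p' j| ≤ D) (hq' : ∀ j, |q' j| ≤ D) :
    bobkovFunctional t p q p' q' ≤ √(C ^ 2 + T * ∑ _j : ι, (D + D) ^ 2) := by
  have hρ0 : 0 < q / p := div_pos hq hp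
  have hρ1 : q / p < 1 := (div_lt_one hp).2 hqp
  refine Real.sqrt_le_sqrt (add_le_add ?_ (mul_le_mul htT (Finset.sum_le_sum fun j _ => ?_)
    (Finset.sum_nonneg fun j _ => sq_nonneg _) (ht.trans htT)))
  · refine pow_le_pow_left₀ (mul_pos hp (isoI_pos _)).le ?_ 2
    nlinarith [isoI_le_one (q / p)]
  · refine sq_le_sq' ?_ ?_
    · nlinarith [abs_le.1 (hq' j), abs_le.1 (hp' j)]
    · nlinarith [abs_le.1 (hq' j), abs_le.1 (hp' j)]

/-- Cauchy–Schwarz: the functional dominates its affine minorants. -/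
lemma minorant_le_bobkovFunctional (ht : 0 ≤ t) (hp : 0 < p) {a : ℝ} (ha : 0 < a) (c : ι → ℝ) :
    (a * (p * isoI (q / p)) + t * (∑ j, c j * q' j - q / p * ∑ j, c j * p' j)) /
      √(a ^ 2 + t * ∑ j, c j ^ 2) ≤ bobkovFunctional t p q p' q' := by
  have hc : 0 ≤ ∑ j, c j ^ 2 := Finset.sum_nonneg fun j _ => sq_nonneg _
  have hpos : 0 < a ^ 2 + t * ∑ j, c j ^ 2 := by positivity
  rw [div_le_iff₀ (Real.sqrt_pos.2 hpos), bobkovFunctional, ← Real.sqrt_mul' _ hpos.le]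
  refine Real.le_sqrt_of_sq_le ?_
  have h1 : ∑ j, c j * q' j - q / p * ∑ j, c j * p' j = ∑ j, c j * (q' j - q / p * p' j) := by
    rw [Finset.mul_sum, ← Finset.sum_sub_distrib]
    exact Finset.sum_congr rfl fun j _ => by ring
  have h2 := Finset.sum_mul_sq_le_sq_mul_sq Finset.univ c fun j => q' j - q / p * p' j
  rw [h1]
  set X := p * isoI (q / p)
  set Y := ∑ j, c j * (q' j - q / p * p' j)
  set A := ∑ j, c j ^ 2
  set B := ∑ j, (q' j - q / p * p' j) ^ 2
  have hB : 0 ≤ B := Finset.sum_nonneg fun j _ => sq_nonneg _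
  have h3 : 2 * (a * X) * Y ≤ a ^ 2 * B + X ^ 2 * A := by
    have hAB : |Y| ≤ √A * √B := by
      rw [← Real.sqrt_mul hc]; exact Real.abs_le_sqrt h2
    have hX : 0 ≤ X := (mul_pos hp (isoI_pos _)).le
    have hA2 := Real.sq_sqrt hc
    have hB2 := Real.sq_sqrt hB
    calc 2 * (a * X) * Y ≤ 2 * (a * X) * (√A * √B) := by
          gcongr; exact (le_abs_self Y).trans hAB
      _ ≤ a ^ 2 * √B ^ 2 + X ^ 2 * √A ^ 2 := by nlinarith [sq_nonneg (a * √B - X * √A)]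
      _ = _ := by rw [hA2, hB2]
  nlinarith [mul_le_mul_of_nonneg_left h3 ht, mul_le_mul_of_nonneg_left h2 (sq_nonneg t)]

/-- Equality case of `minorant_le_bobkovFunctional`. -/
lemma minorant_eq_bobkovFunctional (ht : 0 ≤ t) (hp : 0 < p) {c : ι → ℝ}
    (hc : ∀ j, c j = (q' j - q / p * p' j) / p) :
    (isoI (q / p) * (p * isoI (q / p)) + t * (∑ j, c j * q' j - q / p * ∑ j, c j * p' j)) /
      √(isoI (q / p) ^ 2 + t * ∑ j, c j ^ 2) = bobkovFunctional t p q p' q' := by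
  have hI := isoI_pos (q / p)
  have hc0 : 0 ≤ ∑ j, c j ^ 2 := Finset.sum_nonneg fun j _ => sq_nonneg _
  have hpos : 0 < isoI (q / p) ^ 2 + t * ∑ j, c j ^ 2 := by positivity
  have h1 : ∑ j, c j * q' j - q / p * ∑ j, c j * p' j = p * ∑ j, c j ^ 2 := by
    rw [Finset.mul_sum, Finset.mul_sum, ← Finset.sum_sub_distrib]
    exact Finset.sum_congr rfl fun j _ => by rw [hc]; field_simp
  have h2 : ∑ j, (q' j - q / p * p' j) ^ 2 = p ^ 2 * ∑ j, c j ^ 2 := by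
    rw [Finset.mul_sum]
    exact Finset.sum_congr rfl fun j _ => by rw [hc]; field_simp
  rw [bobkovFunctional, h1, h2, div_eq_iff (Real.sqrt_pos.2 hpos).ne',
    show (p * isoI (q / p)) ^ 2 + t * (p ^ 2 * ∑ j, c j ^ 2) =
      p ^ 2 * (isoI (q / p) ^ 2 + t * ∑ j, c j ^ 2) by ring,
    Real.sqrt_mul (sq_nonneg p), Real.sqrt_sq hp.le, mul_assoc, Real.mul_self_sqrt hpos.le]
  ring

lemma bobkovFunctional_eq (hp : 0 < p) {ρ : ℝ} (hρ : q / p = ρ) {d : ι → ℝ}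
    (hd : ∀ j, q' j - ρ * p' j = p * d j) :
    bobkovFunctional t p q p' q' = p * √(isoI ρ ^ 2 + t * ∑ j, d j ^ 2) := by
  simp only [bobkovFunctional, hρ, hd]
  rw [← Real.sqrt_sq hp.le, ← Real.sqrt_mul (sq_nonneg _), Real.sqrt_sq hp.le]
  congr 1
  simp only [mul_pow, ← Finset.mul_sum]
  ring

lemma continuous_bobkovFunctional {X : Type} [TopologicalSpace X] {t p q : X → ℝ}
    {p' q' : X → ι → ℝ} (ht : Continuous t) (hp : Continuous p) (hq : Continuous q)
    (hp' : ∀ j, Continuous fun x => p' x j) (hq' : ∀ j, Continuous fun x => q' x j)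
    (h0 : ∀ x, 0 < q x) (h1 : ∀ x, q x < p x) :
    Continuous fun x => bobkovFunctional (t x) (p x) (q x) (p' x) (q' x) := by
  have hρ : Continuous fun x => q x / p x := hq.div hp fun x => ((h0 x).trans (h1 x)).ne'
  have hI : Continuous fun x => isoI (q x / p x) := by
    refine (continuous_isoIbar.comp hρ).congr fun x => ?_
    exact isoIbar_eq (div_pos (h0 x) ((h0 x).trans (h1 x)))
      ((div_lt_one ((h0 x).trans (h1 x))).2 (h1 x))
  unfold bobkovFunctional
  fun_prop

end Functional

section Comparison

variable {V : Type} [NormedAddCommGroup V] [InnerProductSpace ℝ V] [FiniteDimensional ℝ V]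
  [MeasurableSpace V] [BorelSpace V] {ι : Type} [Fintype ι] (b : OrthonormalBasis ι ℝ V)

/-- Parabolic comparison principle for bounded subsolutions in the viscosity sense. -/
lemma le_heat_of_minorants {T M : ℝ} (hT : 0 < T) {H : ℝ → V → ℝ}
    (hH : Continuous fun z : ℝ × V => H z.1 z.2) (hM : ∀ t ∈ Icc 0 T, ∀ x, |H t x| ≤ M)
    (h : ∀ t ∈ Ico 0 T, ∀ x, ∃ (N : ℝ → V → ℝ) (Nt : ℝ) (N₁ N₂ : ι → ℝ),
      HasParabolicJet b N t x Nt N₁ N₂ ∧ 0 ≤ Nt + 1 / 2 * ∑ i, N₂ i ∧ N t x = H t x ∧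
      ∀ τ ∈ Icc t T, ∀ y, N τ y ≤ H τ y) :
    H 0 0 ≤ heat T (H T) 0 := by
  by_contra! hlt
  have hTc : Continuous (H T) := hH.comp (by fun_prop : Continuous fun x : V => (T, x))
  have hTM := hM T ⟨hT.le, le_rfl⟩
  have hM0 : 0 ≤ M := (abs_nonneg _).trans (hTM 0)
  set d : ℝ := (Fintype.card ι : ℝ) + 1 with hd
  have hd0 : 0 < d := by positivity
  set ε := (H 0 0 - heat T (H T) 0) / (2 * d * T) with hε
  have hε0 : 0 < ε := div_pos (sub_pos.2 hlt) (by positivity)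
  have hεd : ε * (d * T) = (H 0 0 - heat T (H T) 0) / 2 := by rw [hε]; field_simp
  let w (t : ℝ) (x : V) : ℝ := heat (T - t) (H T) x - H t x + ε * (‖x‖ ^ 2 + d * (T - t))
  have hwc : Continuous fun z : ℝ × V => w z.1 z.2 :=
    (((continuous_heat hTc hTM).comp (by fun_prop : Continuous fun z : ℝ × V =>
      (T - z.1, z.2))).sub hH).add (by fun_prop)
  set r : ℝ := 2 * M / ε + 1 with hr
  have hr1 : 1 ≤ r := by rw [hr]; have : 0 ≤ 2 * M / ε := by positivity
                         linarith
  have hcomp : IsCompact (Icc 0 T ×ˢ Metric.closedBall (0 : V) r) :=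
    isCompact_Icc.prod (isCompact_closedBall _ _)
  have h00 : ((0 : ℝ), (0 : V)) ∈ Icc 0 T ×ˢ Metric.closedBall (0 : V) r :=
    ⟨⟨le_rfl, hT.le⟩, Metric.mem_closedBall_self (by linarith)⟩
  obtain ⟨⟨t, x⟩, ⟨ht, hx⟩, hmin⟩ := hcomp.exists_isMinOn ⟨_, h00⟩ hwc.continuousOn
  have hneg : w t x < 0 := by
    refine (hmin h00).trans_lt ?_
    simp only [w, sub_zero, norm_zero]
    linarith
  simp only at ht hx
  have htT : t < T := by
    refine lt_of_le_of_ne ht.2 ?_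
    rintro rfl
    simp only [w, sub_self, heat_zero, mul_zero, add_zero, zero_add] at hneg
    exact hneg.not_ge (by positivity)
  have hxr : ‖x‖ < r := by
    by_contra! hxr
    have h1 := (abs_le.1 (abs_heat_le hTM (T - t) x)).1
    have h2 := (abs_le.1 (hM t ht x)).2
    have h3 : 2 * M ≤ ε * ‖x‖ ^ 2 := by
      calc 2 * M ≤ ε * r := by rw [hr, mul_add, mul_div_cancel₀ _ hε0.ne']; linarith
        _ ≤ ε * ‖x‖ ^ 2 := by gcongr; nlinarith
    have h4 : 0 ≤ ε * (d * (T - t)) :=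
      mul_nonneg hε0.le (mul_nonneg hd0.le (sub_pos.2 htT).le)
    simp only [w] at hneg
    nlinarith
  obtain ⟨N, Nt, N₁, N₂, hN, hcal, hNH, hNle⟩ := h t ⟨ht.1, htT⟩ x
  have hjet := ((hasParabolicJet_heat b hTc hTM htT x).sub hN).add
    (hasParabolicJet_sq_norm_add (b := b) (t := t) (x := x) d T b.norm_eq_one ε)
  have hwle (τ : ℝ) (hτ : τ ∈ Icc t T) (y : V) (hy : ‖y‖ ≤ r) :
      w t x ≤ heat (T - τ) (H T) y - N τ y + ε * (‖y‖ ^ 2 + d * (T - τ)) := by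
    have h1 : w t x ≤ w τ y := hmin (a := (τ, y)) ⟨⟨ht.1.trans hτ.1, hτ.2⟩, by simpa using hy⟩
    have h2 := hNle τ hτ y
    simp only [w] at h1 ⊢
    linarith
  have hweq : heat (T - t) (H T) x - N t x + ε * (‖x‖ ^ 2 + d * (T - t)) = w t x := by
    rw [hNH]
  have hfin := hjet.nonneg_of_min htT
    (fun τ hτ => by rw [hweq]; exact hwle τ hτ x hxr.le)
    (by
      have : ∀ᶠ y in 𝓝 x, ‖y‖ < r := continuous_norm.continuousAt.eventually_lt_const hxr
      filter_upwards [this] with y hy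
      rw [hweq]; exact hwle t ⟨le_rfl, htT.le⟩ y hy.le)
  simp only [Pi.add_apply, Pi.sub_apply, Finset.sum_add_distrib, Finset.sum_sub_distrib,
    Finset.sum_const, Finset.card_univ, nsmul_eq_mul] at hfin
  nlinarith

variable {G φ : V → ℝ} {C D T : ℝ}

omit [FiniteDimensional ℝ V] [MeasurableSpace V] [BorelSpace V] in
lemma continuous_fderiv_apply_of_contDiff {ψ : V → ℝ} (hψ : ContDiff ℝ 1 ψ) (v : V) :
    Continuous fun x => fderiv ℝ ψ x v :=
  (hψ.continuous_fderiv one_ne_zero).clm_apply continuous_const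

omit [FiniteDimensional ℝ V] [MeasurableSpace V] [BorelSpace V] in
lemma abs_fderiv_apply_le {ψ : V → ℝ} (h : ∀ x, ‖fderiv ℝ ψ x‖ ≤ D) (v x : V) :
    |fderiv ℝ ψ x v| ≤ D * ‖v‖ :=
  ((fderiv ℝ ψ x).le_opNorm v).trans (by gcongr; exact h x)

lemma heat_fderiv_sum {ψ : V → ℝ} (hψ : ContDiff ℝ 1 ψ) (hC : ∀ x, |ψ x| ≤ C)
    (hD : ∀ x, ‖fderiv ℝ ψ x‖ ≤ D) (c : ι → ℝ) (s : ℝ) (x : V) :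
    heat s (fun y => fderiv ℝ ψ y (∑ j, c j • b j)) x =
      ∑ j, c j * heat s (fun y => fderiv ℝ ψ y (b j)) x := by
  rw [← fderiv_heat_of_contDiff hψ hC hD, map_sum]
  exact Finset.sum_congr rfl fun j _ => by
    rw [map_smul, smul_eq_mul, fderiv_heat_of_contDiff hψ hC hD]

/-- Bobkov's inequality along the heat flow, for an unnormalised log-concave weight `G`. -/
lemma heat_mul_isoI_le (hT : 0 < T) (hG : ContDiff ℝ 1 G) (hφ : ContDiff ℝ 1 φ)
    (hGC : ∀ x, |G x| ≤ C) (hφC : ∀ x, |φ x| ≤ C) (hGD : ∀ x, ‖fderiv ℝ G x‖ ≤ D)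
    (hφD : ∀ x, ‖fderiv ℝ φ x‖ ≤ D) (h0 : ∀ x, 0 < φ x) (h1 : ∀ x, φ x < G x)
    (hlog : ∀ s, MidLogConcave (heat s G)) :
    heat T G 0 * isoI (heat T φ 0 / heat T G 0) ≤
      heat T (fun x => bobkovFunctional T (G x) (φ x) (fun j => fderiv ℝ G x (b j))
        fun j => fderiv ℝ φ x (b j)) 0 := by
  have hGpos (x) : 0 < G x := (h0 x).trans (h1 x)
  have hu0 (s x) : 0 < heat s φ x := heat_pos hφ.continuous hφC h0 s x
  have hug (s x) : heat s φ x < heat s G x :=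
    heat_lt hφ.continuous hφC hG.continuous hGC h1 s x
  have hg0 (s x) : 0 < heat s G x := (hu0 s x).trans (hug s x)
  have hGc (v : V) := continuous_fderiv_apply_of_contDiff hG v
  have hφc (v : V) := continuous_fderiv_apply_of_contDiff hφ v
  have hGb (v : V) := abs_fderiv_apply_le hGD v
  have hφb (v : V) := abs_fderiv_apply_le hφD v
  have hGb1 (j : ι) (x : V) : |fderiv ℝ G x (b j)| ≤ D := by simpa using hGb (b j) x
  have hφb1 (j : ι) (x : V) : |fderiv ℝ φ x (b j)| ≤ D := by simpa using hφb (b j) x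
  let H (t : ℝ) (x : V) : ℝ := bobkovFunctional t (heat (T - t) G x) (heat (T - t) φ x)
    (fun j => heat (T - t) (fun y => fderiv ℝ G y (b j)) x)
    fun j => heat (T - t) (fun y => fderiv ℝ φ y (b j)) x
  have hcont {ψ : V → ℝ} (hψ : Continuous ψ) {B : ℝ} (hB : ∀ x, |ψ x| ≤ B) :
      Continuous fun z : ℝ × V => heat (T - z.1) ψ z.2 :=
    (continuous_heat hψ hB).comp (by fun_prop : Continuous fun z : ℝ × V => (T - z.1, z.2))
  have key := le_heat_of_minorants b (H := H) (M := √(C ^ 2 + T * ∑ _j : ι, (D + D) ^ 2)) hT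
    (continuous_bobkovFunctional continuous_fst (hcont hG.continuous hGC)
      (hcont hφ.continuous hφC) (fun j => hcont (hGc _) (hGb _)) (fun j => hcont (hφc _) (hφb _))
      (fun z => hu0 _ _) fun z => hug _ _)
    (fun t ht x => by
      refine (abs_of_nonneg (Real.sqrt_nonneg _ : 0 ≤ H t x)).trans_le ?_
      exact bobkovFunctional_le ht.1 ht.2 (hg0 _ _) (hu0 _ _) (hug _ _)
        ((le_abs_self _).trans (abs_heat_le hGC _ x))
        (fun j => abs_heat_le (hGb1 j) _ x)
        (fun j => abs_heat_le (hφb1 j) _ x)) ?_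
  · simp only [H, sub_zero, bobkovFunctional_zero (hg0 _ _), sub_self, heat_zero] at key
    exact key
  · rintro t ⟨ht0, htT⟩ x
    have hs : 0 < T - t := sub_pos.2 htT
    set g := heat (T - t) G x with hg
    set ρ := heat (T - t) φ x / g with hρ
    have hgp : 0 < g := hg0 _ _
    let c (j : ι) : ℝ := (heat (T - t) (fun y => fderiv ℝ φ y (b j)) x -
      ρ * heat (T - t) (fun y => fderiv ℝ G y (b j)) x) / g
    set v : V := ∑ j, c j • b j with hv
    set A : ℝ := ∑ j, c j ^ 2 with hA
    have hA0 : 0 ≤ A := Finset.sum_nonneg fun j _ => sq_nonneg _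
    have hI : 0 < isoI ρ := isoI_pos ρ
    have hS0 : 0 < isoI ρ ^ 2 + t * A := by positivity
    have hPsum (s y) : heat s (fun z => fderiv ℝ G z v) y = _ := heat_fderiv_sum b hG hGC hGD c s y
    have hQsum (s y) : heat s (fun z => fderiv ℝ φ z v) y = _ := heat_fderiv_sum b hφ hφC hφD c s y
    obtain ⟨N₁, hN⟩ := (hasParabolicJet_heat b hG.continuous hGC htT x).minorant
      (hasParabolicJet_heat b hφ.continuous hφC htT x)
      (hasParabolicJet_heat b (hGc v) (hGb v) htT x)
      (hasParabolicJet_heat b (hφc v) (hφb v) htT x) (fun _ _ => hu0 _ _) (fun _ _ => hug _ _)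
      (a := isoI ρ) (c := A) hρ.symm rfl (Real.sqrt_pos.2 hS0)
    refine ⟨_, _, _, _, hN, ?_, ?_, fun τ hτ y => ?_⟩
    · have hdiff (j : ι) : heat (T - t) (fun y => fderiv ℝ φ y (b j)) x -
          ρ * heat (T - t) (fun y => fderiv ℝ G y (b j)) x = g * c j := by
        simp only [c]; field_simp
      refine caloric_minorant_nonneg hgp hI (Real.sqrt_pos.2 hS0) ht0 (Real.sq_sqrt hS0.le) rfl
        (c := c) (fun i => ?_) ?_ ?_ ?_
      · rw [fderiv_heat_of_contDiff hφ hφC hφD, fderiv_heat_of_contDiff hG hGC hGD]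
        exact hdiff i
      · simp only [hPsum, hQsum]
        rw [hA, Finset.mul_sum, Finset.mul_sum, ← Finset.sum_sub_distrib]
        refine Finset.sum_congr rfl fun j _ => ?_
        linear_combination c j * hdiff j
      · simp only [hPsum, fderiv_heat_of_contDiff hG hGC hGD]
      · have h2 := heat_mul_fderiv_fderiv_le hG.continuous hGC hs (hlog _) x v
        simp only [fderiv_heat_of_contDiff hG hGC hGD] at h2
        refine le_trans (le_of_eq ?_) h2
        rw [← hg]
        congr 1
        conv_rhs => rw [hv, map_sum]
        simp only [map_smul, smul_eq_mul]
        rfl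
    · simp only [minorant, hPsum, hQsum]
      exact minorant_eq_bobkovFunctional ht0 hgp fun j => rfl
    · simp only [minorant, hPsum, hQsum]
      exact minorant_le_bobkovFunctional (ht0.trans hτ.1) (hg0 _ _) hI c

end Comparison

section Smoothing

variable {V : Type} [NormedAddCommGroup V] [InnerProductSpace ℝ V] [FiniteDimensional ℝ V]
  [MeasurableSpace V] [BorelSpace V] {C D T : ℝ}

omit [MeasurableSpace V] [BorelSpace V] in
lemma OrthonormalBasis.sum_sq_apply {ι : Type} [Fintype ι] (b : OrthonormalBasis ι ℝ V)
    (L : V →L[ℝ] ℝ) : ∑ j, L (b j) ^ 2 = ‖L‖ ^ 2 := by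
  have h := b.sum_sq_norm_inner_right ((InnerProductSpace.toDual ℝ V).symm L)
  rw [LinearIsometryEquiv.norm_map] at h
  rw [← h]
  refine Finset.sum_congr rfl fun j _ => ?_
  rw [Real.norm_eq_abs, sq_abs, real_inner_comm, InnerProductSpace.toDual_symm_apply]

/-- Bobkov's inequality for a smooth log-concave density relative to a Gaussian, and for functions
with values in the open unit interval. -/
lemma heat_mul_isoIbar_le_of_contDiff {G f : V → ℝ} (hT : 0 < T) (hG : ContDiff ℝ 1 G)
    (hf : ContDiff ℝ 1 f) (hGC : ∀ x, |G x| ≤ C) (hGD : ∀ x, ‖fderiv ℝ G x‖ ≤ D)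
    (hfD : ∀ x, ‖fderiv ℝ f x‖ ≤ D) (hG0 : ∀ x, 0 < G x) (h0 : ∀ x, 0 < f x) (h1 : ∀ x, f x < 1)
    (hlog : ∀ s, MidLogConcave (heat s G)) :
    heat T G 0 * isoIbar (heat T (fun x => G x * f x) 0 / heat T G 0) ≤
      heat T (fun x => G x * √(isoIbar (f x) ^ 2 + T * ‖fderiv ℝ f x‖ ^ 2)) 0 := by
  have hφ : ContDiff ℝ 1 fun x => G x * f x := hG.mul hf
  have hφ0 (x) : 0 < G x * f x := mul_pos (hG0 x) (h0 x)
  have hφ1 (x) : G x * f x < G x := mul_lt_of_lt_one_right (hG0 x) (h1 x)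
  have hφC (x) : |G x * f x| ≤ C := by
    rw [abs_of_pos (hφ0 x)]; exact (hφ1 x).le.trans ((le_abs_self _).trans (hGC x))
  have hd (x v : V) : fderiv ℝ (fun x => G x * f x) x v =
      G x * fderiv ℝ f x v + f x * fderiv ℝ G x v := by
    rw [fderiv_fun_mul (hG.differentiable one_ne_zero x) (hf.differentiable one_ne_zero x)]
    simp
  have hD0 : 0 ≤ D := (norm_nonneg _).trans (hGD 0)
  have hC0 : 0 ≤ C := (abs_nonneg _).trans (hGC 0)
  have hφD (x) : ‖fderiv ℝ (fun x => G x * f x) x‖ ≤ D + C * D := by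
    refine ContinuousLinearMap.opNorm_le_bound _ (by positivity) fun v => ?_
    rw [hd, Real.norm_eq_abs]
    refine (abs_add_le _ _).trans ?_
    rw [abs_mul, abs_mul, abs_of_pos (h0 x), add_mul, add_comm (D * _), mul_assoc]
    refine add_le_add (mul_le_mul (hGC x) (abs_fderiv_apply_le hfD v x) (abs_nonneg _) hC0) ?_
    exact (mul_le_of_le_one_left (abs_nonneg _) (h1 x).le).trans (abs_fderiv_apply_le hGD v x)
  have key := heat_mul_isoI_le (stdOrthonormalBasis ℝ V) hT hG hφ hGC hφC
    (fun x => (hGD x).trans (le_add_of_nonneg_right (by positivity))) hφD hφ0 hφ1 hlog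
  have hm : 0 < heat T G 0 := heat_pos hG.continuous hGC hG0 T 0
  rw [isoIbar_eq (div_pos (heat_pos hφ.continuous hφC hφ0 T 0) hm)
    ((div_lt_one hm).2 (heat_lt hφ.continuous hφC hG.continuous hGC hφ1 T 0))]
  refine key.trans (le_of_eq ?_)
  congr 1
  funext x
  rw [bobkovFunctional_eq (hG0 x) (mul_div_cancel_left₀ _ (hG0 x).ne')
    (d := fun j => fderiv ℝ f x (stdOrthonormalBasis ℝ V j)) fun j => by rw [hd]; ring,
    OrthonormalBasis.sum_sq_apply, isoIbar_eq (h0 x) (h1 x)]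

lemma tendsto_heat_of_tendsto {ψ : ℕ → V → ℝ} {ψ' : V → ℝ} (hψ : ∀ k, Continuous (ψ k))
    (hC : ∀ k x, |ψ k x| ≤ C) (h : ∀ x, Tendsto (fun k => ψ k x) atTop (𝓝 (ψ' x))) (s : ℝ) (x : V) :
    Tendsto (fun k => heat s (ψ k) x) atTop (𝓝 (heat s ψ' x)) :=
  tendsto_integral_of_dominated_convergence (fun z => gaussWeight z * C)
    (fun k => (integrable_heat (hψ k) (hC k) s x).aestronglyMeasurable)
    (integrable_gaussWeight.mul_const C)
    (fun k => ae_of_all _ fun z => by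
      rw [norm_mul, Real.norm_of_nonneg (gaussWeight_pos z).le]
      exact mul_le_mul_of_nonneg_left (hC k _) (gaussWeight_pos z).le)
    (ae_of_all _ fun z => (h _).const_mul _)

end Smoothing

section LogConcave

variable {n : ℕ} {C D T : ℝ}

/-- Bobkov's inequality for a log-concave density relative to a Gaussian. -/
lemma heat_mul_isoIbar_le {G f : EuclideanSpace ℝ (Fin n) → ℝ} (hT : 0 < T) (hG : Continuous G)
    (hf : ContDiff ℝ 1 f) (hGC : ∀ x, |G x| ≤ C) (hfD : ∀ x, ‖fderiv ℝ f x‖ ≤ D)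
    (hG0 : ∀ x, 0 < G x) (hf01 : ∀ x, f x ∈ Icc (0 : ℝ) 1) (hlog : MidLogConcave G) :
    heat T G 0 * isoIbar (heat T (fun x => G x * f x) 0 / heat T G 0) ≤
      heat T (fun x => G x * √(isoIbar (f x) ^ 2 + T * ‖fderiv ℝ f x‖ ^ 2)) 0 := by
  have hC0 : 0 ≤ C := (abs_nonneg _).trans (hGC 0)
  have hD0 : 0 ≤ D := (norm_nonneg _).trans (hfD 0)
  let e (k : ℕ) : ℝ := 1 / ((k : ℝ) + 1)
  have he (k) : 0 < e k := Nat.one_div_pos_of_nat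
  have he1 (k) : e k ≤ 1 := by
    refine div_le_one_of_le₀ ?_ (by positivity)
    linarith [Nat.cast_nonneg (α := ℝ) k]
  have hlim : Tendsto e atTop (𝓝 0) := tendsto_one_div_add_atTop_nhds_zero_nat
  let g (k : ℕ) : EuclideanSpace ℝ (Fin n) → ℝ := heat (e k) G
  let F (k : ℕ) (x : EuclideanSpace ℝ (Fin n)) : ℝ := e k / 3 + (1 - 2 * (e k / 3)) * f x
  have hgC (k x) : |g k x| ≤ C := abs_heat_le hGC _ x
  have hg0 (k x) : 0 < g k x := heat_pos hG hGC hG0 _ x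
  have hgc (k) : ContDiff ℝ 1 (g k) := (contDiff_heat hG hGC (he k)).of_le one_le_two
  have hF0 (k x) : 0 < F k x := by
    have := he k; have := he1 k; have := (hf01 x).1
    have : 0 ≤ (1 - 2 * (e k / 3)) * f x := mul_nonneg (by linarith) this
    simp only [F]; linarith
  have hF1 (k x) : F k x < 1 := by
    have := he k; have := he1 k; have := (hf01 x).2
    have : (1 - 2 * (e k / 3)) * f x ≤ (1 - 2 * (e k / 3)) * 1 :=
      mul_le_mul_of_nonneg_left this (by linarith)
    simp only [F]; linarith
  have hFc (k) : ContDiff ℝ 1 (F k) := contDiff_const.add (contDiff_const.mul hf)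
  have hFd (k x) : fderiv ℝ (F k) x = (1 - 2 * (e k / 3)) • fderiv ℝ f x := by
    simp only [F]
    rw [fderiv_const_add, fderiv_const_mul (hf.differentiable one_ne_zero x)]
  have hFD (k x) : ‖fderiv ℝ (F k) x‖ ≤ D := by
    have := he k; have := he1 k
    rw [hFd, norm_smul, Real.norm_of_nonneg (by linarith)]
    exact (mul_le_of_le_one_left (norm_nonneg _) (by linarith)).trans (hfD x)
  choose D' hD' using fun k => exists_norm_fderiv_heat_le hG hGC (he k)
  have hineq (k) := heat_mul_isoIbar_le_of_contDiff (D := max D (D' k)) hT (hgc k) (hFc k) (hgC k)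
      (fun x => (hD' k x).trans (le_max_right _ _)) (fun x => (hFD k x).trans (le_max_left _ _))
      (hg0 k) (hF0 k) (hF1 k)
      ((hlog.heat hG hGC (fun x => (hG0 x).le) _).heat (hgc k).continuous (hgC k)
        fun x => (hg0 k x).le)
  have hglim (x) : Tendsto (fun k => g k x) atTop (𝓝 (G x)) := by
    have h := ((continuous_heat hG hGC).comp
      (by fun_prop : Continuous fun s : ℝ => (s, x))).tendsto 0
    simp only [Function.comp_def, heat_zero] at h
    exact h.comp hlim
  have hFlim (x) : Tendsto (fun k => F k x) atTop (𝓝 (f x)) := by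
    have h := (hlim.div_const 3).add ((((hlim.div_const 3).const_mul 2).const_sub 1).mul_const (f x))
    simpa using h
  have hDlim (x) : Tendsto (fun k => ‖fderiv ℝ (F k) x‖) atTop (𝓝 ‖fderiv ℝ f x‖) := by
    have h := ((((hlim.div_const 3).const_mul 2).const_sub 1).smul_const (fderiv ℝ f x)).norm
    simp only [hFd]
    simpa using h
  have hFdc (k) : Continuous fun x => ‖fderiv ℝ (F k) x‖ :=
    ((hFc k).continuous_fderiv one_ne_zero).norm
  have hm : 0 < heat T G 0 := heat_pos hG hGC hG0 T 0
  have hlim₁ := tendsto_heat_of_tendsto (fun k => (hgc k).continuous) hgC hglim T 0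
  have hlim₂ := tendsto_heat_of_tendsto (ψ := fun k x => g k x * F k x) (C := C)
    (fun k => (hgc k).continuous.mul (hFc k).continuous)
    (fun k x => by
      rw [abs_mul, abs_of_pos (hF0 k x)]
      exact (mul_le_of_le_one_right (abs_nonneg _) (hF1 k x).le).trans (hgC k x))
    (fun x => (hglim x).mul (hFlim x)) T 0
  have hlim₃ := tendsto_heat_of_tendsto (C := C * √(1 ^ 2 + T * D ^ 2))
    (ψ := fun k x => g k x * √(isoIbar (F k x) ^ 2 + T * ‖fderiv ℝ (F k) x‖ ^ 2))
    (fun k => (hgc k).continuous.mul (((continuous_isoIbar.comp (hFc k).continuous).pow 2).add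
      (continuous_const.mul ((hFdc k).pow 2))).sqrt)
    (fun k x => by
      rw [abs_mul, abs_of_nonneg (Real.sqrt_nonneg _)]
      refine mul_le_mul (hgC k x) (Real.sqrt_le_sqrt ?_) (Real.sqrt_nonneg _) hC0
      have := isoIbar_nonneg (F k x)
      gcongr
      · exact isoIbar_le_one _
      · exact hFD k x)
    (fun x => (hglim x).mul (((((continuous_isoIbar.tendsto _).comp (hFlim x)).pow 2).add
      (((hDlim x).pow 2).const_mul T)).sqrt)) T 0
  exact le_of_tendsto_of_tendsto'
    (hlim₁.mul ((continuous_isoIbar.tendsto _).comp (hlim₂.div hlim₁ hm.ne'))) hlim₃ hineq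

end LogConcave

section Potential

variable {V : Type} [NormedAddCommGroup V] [InnerProductSpace ℝ V]

/-- Second-order lower bound for a uniformly convex function. -/
lemma add_fderiv_add_le_of_hess_ge {U : V → ℝ} {R : ℝ} (hU : ContDiff ℝ 2 U)
    (hHess : ∀ x v, R * ‖v‖ ^ 2 ≤ fderiv ℝ (fderiv ℝ U) x v v) (x h : V) :
    U x + fderiv ℝ U x h + R / 2 * ‖h‖ ^ 2 ≤ U (x + h) := by
  have hline (r : ℝ) : HasDerivAt (fun r : ℝ => x + r • h) h r := by
    simpa using ((hasDerivAt_id r).smul_const h).const_add x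
  have hU' : Differentiable ℝ (fderiv ℝ U) :=
    (hU.fderiv_right (m := 1) (by norm_num)).differentiable one_ne_zero
  let p (r : ℝ) : ℝ := fderiv ℝ U (x + r • h) h - fderiv ℝ U x h - r * (R * ‖h‖ ^ 2)
  have hp (r : ℝ) : HasDerivAt p
      (fderiv ℝ (fderiv ℝ U) (x + r • h) h h - 1 * (R * ‖h‖ ^ 2)) r := by
    have h1 : HasDerivAt (fun r : ℝ => fderiv ℝ U (x + r • h))
        (fderiv ℝ (fderiv ℝ U) (x + r • h) h) r :=
      (hU' _).hasFDerivAt.comp_hasDerivAt r (hline r)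
    simpa using ((h1.clm_apply (hasDerivAt_const r h)).sub_const (fderiv ℝ U x h)).fun_sub
      ((hasDerivAt_id r).mul_const (R * ‖h‖ ^ 2))
  let q (r : ℝ) : ℝ := U (x + r • h) - r * fderiv ℝ U x h - r ^ 2 * (R / 2 * ‖h‖ ^ 2)
  have hq (r : ℝ) : HasDerivAt q (p r) r := by
    have h1 := (((hU.differentiable two_ne_zero _).hasFDerivAt.comp_hasDerivAt r (hline r)).sub
      ((hasDerivAt_id r).mul_const (fderiv ℝ U x h))).sub
      (((hasDerivAt_id r).pow 2).mul_const (R / 2 * ‖h‖ ^ 2))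
    refine h1.congr_deriv ?_
    simp only [p, id]
    push_cast
    ring
  have hpm : Monotone p := monotone_of_deriv_nonneg (fun r => (hp r).differentiableAt) fun r => by
    rw [(hp r).deriv, one_mul]
    exact sub_nonneg.2 (hHess _ _)
  have hp0 : p 0 = 0 := by simp [p]
  have hqm : MonotoneOn q (Ici 0) := monotoneOn_of_deriv_nonneg (convex_Ici 0)
    (fun r _ => (hq r).continuousAt.continuousWithinAt)
    (fun r _ => (hq r).differentiableAt.differentiableWithinAt) fun r hr => by
      rw [(hq r).deriv, ← hp0]
      exact hpm (interior_subset hr)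
  have := hqm (mem_Ici.2 le_rfl) (mem_Ici.2 zero_le_one) zero_le_one
  simp only [q, zero_smul, one_smul, add_zero] at this
  linarith

variable {U : V → ℝ} {R r : ℝ}

lemma midLogConcave_exp_neg_add (hU : ContDiff ℝ 2 U)
    (hHess : ∀ x v, R * ‖v‖ ^ 2 ≤ fderiv ℝ (fderiv ℝ U) x v v) (hr : r ≤ R) :
    MidLogConcave fun x => Real.exp (-U x + r / 2 * ‖x‖ ^ 2) := by
  intro x h
  rw [← Real.exp_add, ← Real.exp_nat_mul, Real.exp_le_exp]
  have h1 := add_fderiv_add_le_of_hess_ge hU hHess x h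
  have h2 := add_fderiv_add_le_of_hess_ge hU hHess x (-h)
  simp only [map_neg, norm_neg, ← sub_eq_add_neg] at h2
  have h3 := parallelogram_law_with_norm ℝ x h
  have h4 : r * ‖h‖ ^ 2 ≤ R * ‖h‖ ^ 2 := by gcongr
  have h5 := congrArg (r / 2 * ·) h3
  push_cast
  linarith

lemma exists_exp_neg_add_le (hU : ContDiff ℝ 2 U)
    (hHess : ∀ x v, R * ‖v‖ ^ 2 ≤ fderiv ℝ (fderiv ℝ U) x v v) (hr : r < R) :
    ∃ C, ∀ x, Real.exp (-U x + r / 2 * ‖x‖ ^ 2) ≤ C := by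
  set L := ‖fderiv ℝ U 0‖
  refine ⟨Real.exp (-U 0 + L ^ 2 / (2 * (R - r))), fun x => Real.exp_le_exp.2 ?_⟩
  have hd : 0 < R - r := sub_pos.2 hr
  have h1 := add_fderiv_add_le_of_hess_ge hU hHess 0 x
  rw [zero_add] at h1
  have h2 : -(L * ‖x‖) ≤ fderiv ℝ U 0 x := (abs_le.1 ((fderiv ℝ U 0).le_opNorm x)).1
  have h3 : L * ‖x‖ - (R - r) / 2 * ‖x‖ ^ 2 ≤ L ^ 2 / (2 * (R - r)) := by
    rw [le_div_iff₀ (by positivity)]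
    nlinarith [sq_nonneg (L - (R - r) * ‖x‖)]
  linarith

end Potential

section Weight

variable {V : Type} [NormedAddCommGroup V] [InnerProductSpace ℝ V] [FiniteDimensional ℝ V]
  [MeasurableSpace V] [BorelSpace V]

lemma exists_heat_eq_mul_integral {r : ℝ} (hr : 0 < r) :
    ∃ κ : ℝ, 0 < κ ∧ ∀ ψ : V → ℝ,
      heat (1 / r) ψ 0 = κ * ∫ y, Real.exp (-(r / 2 * ‖y‖ ^ 2)) * ψ y := by
  refine ⟨(∫ y : V, Real.exp (-‖y‖ ^ 2 / 2))⁻¹ *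
    Real.exp (-(Module.finrank ℝ V / 2) * Real.log (1 / r)),
    mul_pos (inv_pos.2 integral_exp_neg_sq_norm_div_two_pos) (Real.exp_pos _), fun ψ => ?_⟩
  rw [mul_assoc, ← integral_comp_sqrt_smul (one_div_pos.2 hr) fun y : V =>
    Real.exp (-(r / 2 * ‖y‖ ^ 2)) * ψ y, ← integral_const_mul]
  refine integral_congr_ae (ae_of_all _ fun z => ?_)
  have h : r / 2 * ‖√(1 / r) • z‖ ^ 2 = ‖z‖ ^ 2 / 2 := by
    rw [norm_smul, mul_pow, Real.norm_of_nonneg (Real.sqrt_nonneg _),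
      Real.sq_sqrt (one_div_pos.2 hr).le]
    field_simp
  simp only [gaussWeight, h, zero_add, neg_div]
  ring

end Weight

section Main

variable {n : ℕ} {U f : EuclideanSpace ℝ (Fin n) → ℝ} {R D : ℝ}
  {μ : Measure (EuclideanSpace ℝ (Fin n))}

/-- Bobkov's inequality with a constant strictly below the uniform convexity constant. -/
lemma isoIbar_integral_le_of_lt (hU : ContDiff ℝ 2 U)
    (hHess : ∀ x v, R * ‖v‖ ^ 2 ≤ fderiv ℝ (fderiv ℝ U) x v v)
    (hμ : μ = volume.withDensity fun x => ENNReal.ofReal (Real.exp (-U x)))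
    [IsProbabilityMeasure μ] (hf : ContDiff ℝ 1 f) (hf01 : ∀ x, f x ∈ Icc (0 : ℝ) 1)
    (hfD : ∀ x, ‖fderiv ℝ f x‖ ≤ D) {r : ℝ} (hr : 0 < r) (hrR : r < R) :
    isoIbar (∫ x, f x ∂μ) ≤ ∫ x, √(isoIbar (f x) ^ 2 + ‖fderiv ℝ f x‖ ^ 2 / r) ∂μ := by
  obtain ⟨κ, hκ, hκψ⟩ := exists_heat_eq_mul_integral (V := EuclideanSpace ℝ (Fin n)) hr
  obtain ⟨C, hC⟩ := exists_exp_neg_add_le hU hHess hrR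
  let G (x : EuclideanSpace ℝ (Fin n)) : ℝ := Real.exp (-U x + r / 2 * ‖x‖ ^ 2)
  have hUc := hU.continuous
  have hheat (ψ : EuclideanSpace ℝ (Fin n) → ℝ) :
      heat (1 / r) (fun x => G x * ψ x) 0 = κ * ∫ x, ψ x ∂μ := by
    rw [hκψ, hμ, integral_withDensity_eq_integral_toReal_smul (by fun_prop)
      (ae_of_all _ fun _ => ENNReal.ofReal_lt_top)]
    congr 1
    refine integral_congr_ae (ae_of_all _ fun x => ?_)
    simp only [G, ENNReal.toReal_ofReal (Real.exp_pos _).le, smul_eq_mul]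
    rw [← mul_assoc, ← Real.exp_add]
    congr 2
    ring
  have hG1 : heat (1 / r) G 0 = κ := by
    have h := hheat fun _ => 1
    simpa using h
  have key := heat_mul_isoIbar_le (G := G) (f := f) (one_div_pos.2 hr) (by fun_prop) hf
    (fun x => by rw [abs_of_pos (Real.exp_pos _)]; exact hC x) hfD (fun x => Real.exp_pos _) hf01
    (midLogConcave_exp_neg_add hU hHess hrR.le)
  rw [hheat, hheat, hG1, mul_div_cancel_left₀ _ hκ.ne'] at key
  simpa only [one_div_mul_eq_div] using le_of_mul_le_mul_left key hκ

end Main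

/-- Bobkov's inequality for a uniformly log-concave probability
measure `dμ = e^{-U} dx`, `Hess U ≥ R·Id`:
`I(∫ f dμ) ≤ ∫ √(I(f)² + ‖∇f‖²/R) dμ` for smooth `f : ℝⁿ → [0,1]`. -/
theorem stmt_8 (n : ℕ) (R : ℝ) (hR : 0 < R)
    (U : EuclideanSpace ℝ (Fin n) → ℝ) (hU : ContDiff ℝ (⊤ : ℕ∞) U)
    (hHess : ∀ x v : EuclideanSpace ℝ (Fin n), R * ‖v‖ ^ 2 ≤ fderiv ℝ (fderiv ℝ U) x v v)
    (μ : Measure (EuclideanSpace ℝ (Fin n)))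
    (hμ : μ = volume.withDensity (fun x => ENNReal.ofReal (Real.exp (-U x))))
    (hprob : IsProbabilityMeasure μ)
    (f : EuclideanSpace ℝ (Fin n) → ℝ)
    (hf : ContDiff ℝ (⊤ : ℕ∞) f)
    (hrange : ∀ x, f x ∈ Set.Icc (0 : ℝ) 1)
    (hfd : ∀ i : ℕ, ∃ C : ℝ, ∀ x, ‖iteratedFDeriv ℝ i f x‖ ≤ C) :
    isoIbar (∫ x, f x ∂μ)
      ≤ ∫ x, Real.sqrt (isoIbar (f x) ^ 2 + ‖fderiv ℝ f x‖ ^ 2 / R) ∂μ := by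
  obtain ⟨D, hD⟩ := hfd 1
  simp only [norm_iteratedFDeriv_one] at hD
  have hf1 : ContDiff ℝ 1 f := hf.of_le (by exact_mod_cast le_top)
  have hU2 : ContDiff ℝ 2 U := hU.of_le (mod_cast le_top : ((2 : ℕ∞) : WithTop ℕ∞) ≤ (⊤ : ℕ∞))
  have hDc : Continuous fun x => ‖fderiv ℝ f x‖ := (hf1.continuous_fderiv one_ne_zero).norm
  have hev : ∀ᶠ r in 𝓝[<] R, R / 2 < r ∧ r < R :=
    Ioo_mem_nhdsLT (half_lt_self hR)
  have hle : ∀ᶠ r in 𝓝[<] R, isoIbar (∫ x, f x ∂μ) ≤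
      ∫ x, √(isoIbar (f x) ^ 2 + ‖fderiv ℝ f x‖ ^ 2 / r) ∂μ :=
    hev.mono fun r hr => isoIbar_integral_le_of_lt hU2 hHess hμ hf1 hrange hD
      ((half_pos hR).trans hr.1) hr.2
  refine ge_of_tendsto (tendsto_integral_filter_of_dominated_convergence
    (fun _ => √(1 ^ 2 + D ^ 2 / (R / 2))) ?_ ?_ (integrable_const _) ?_) hle
  · refine Eventually.of_forall fun r => Continuous.aestronglyMeasurable ?_
    exact (((continuous_isoIbar.comp hf1.continuous).pow 2).add ((hDc.pow 2).div_const r)).sqrt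
  · filter_upwards [hev] with r hr
    refine ae_of_all _ fun x => ?_
    rw [Real.norm_of_nonneg (Real.sqrt_nonneg _)]
    refine Real.sqrt_le_sqrt (add_le_add
      (pow_le_pow_left₀ (isoIbar_nonneg _) (isoIbar_le_one _) 2) ?_)
    exact div_le_div₀ (sq_nonneg _) (pow_le_pow_left₀ (norm_nonneg _) (hD x) 2) (half_pos hR)
      hr.1.le
  · refine ae_of_all _ fun x => ?_
    have h : Tendsto (fun r : ℝ => r) (𝓝[<] R) (𝓝 R) :=
      tendsto_nhdsWithin_of_tendsto_nhds tendsto_id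
    exact ((tendsto_const_nhds.div h hR.ne').const_add _).sqrt
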